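/- arXiv:1404.4999 — 5 statements merged into one kernel-verified Lean document; each statement's English description precedes it below -/
import Mathlib

section
/- The ring of integers of the real quadratic field ℚ(√14) is a principal ideal domain (equivalently, its class number is 1), while the ideal class group of the ring of integers of the imaginary quadratic field ℚ(√-14) is isomorphic to ℤ/4ℤ. -/
open NumberField IntermediateField Polynomial

/-- `√n` is integral over `ℚ`. -/
theorem sqrtNat_isIntegral (n : ℕ) : IsIntegral ℚ (Real.sqrt n) := by
  refine ⟨X ^ 2 - C (n : ℚ), by monicity!, ?_⟩
  simp [Real.sq_sqrt (by positivity : (0:ℝ) ≤ (n:ℝ))]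

/-- `√(-n) = √n · i` is integral over `ℚ`. -/
theorem sqrtNegNat_isIntegral (n : ℕ) :
    IsIntegral ℚ ((Real.sqrt n : ℂ) * Complex.I) := by
  refine ⟨X ^ 2 + C (n : ℚ), by monicity!, ?_⟩
  have h : ((Real.sqrt n : ℝ) : ℂ) ^ 2 = (n : ℂ) := by
    rw [← Complex.ofReal_pow, Real.sq_sqrt (by positivity : (0:ℝ) ≤ (n:ℝ))]
    simp
  simp [mul_pow, Complex.I_sq, h]

/-- The real quadratic field `ℚ(√n)` is a number field. -/
instance (n : ℕ) : NumberField ℚ⟮Real.sqrt n⟯ :=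
  { to_charZero := inferInstance
    to_finiteDimensional := IntermediateField.adjoin.finiteDimensional (sqrtNat_isIntegral n) }

/-- The imaginary quadratic field `ℚ(√-n)` is a number field. -/
instance (n : ℕ) : NumberField ℚ⟮(Real.sqrt n : ℂ) * Complex.I⟯ :=
  { to_charZero := inferInstance
    to_finiteDimensional :=
      IntermediateField.adjoin.finiteDimensional (sqrtNegNat_isIntegral n) }

theorem Rat.exists_intCast_of_squarefree_mul_sq {d : ℤ} (hd : Squarefree d) {q : ℚ} {k : ℤ}
    (h : (d : ℚ) * q ^ 2 = k) : ∃ n : ℤ, (n : ℚ) = q := by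
  have hq : (d : ℚ) * q.num ^ 2 = k * q.den ^ 2 := by
    rw [← h, mul_assoc, ← mul_pow, Rat.mul_den_eq_num]
  have hdvd : (q.den : ℤ) * q.den ∣ d := by
    have : IsCoprime ((q.den : ℤ) ^ 2) (q.num ^ 2) := by
      refine IsCoprime.pow (Int.isCoprime_iff_gcd_eq_one.mpr ?_)
      simpa [Int.gcd, Nat.Coprime] using q.reduced.symm
    rw [← sq]
    exact this.dvd_of_dvd_mul_right ⟨k, by rw [mul_comm _ k]; exact_mod_cast hq⟩
  have hden : q.den = 1 := by simpa using Int.isUnit_iff_natAbs_eq.mp (hd _ hdvd)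
  exact ⟨q.num, Rat.den_eq_one_iff q |>.mp hden⟩

theorem Int.even_of_four_dvd_sq_sub_mul_sq {d m n : ℤ} (hd : d % 4 = 2 ∨ d % 4 = 3)
    (h : 4 ∣ m ^ 2 - d * n ^ 2) : 2 ∣ m ∧ 2 ∣ n := by
  have hm : m % 4 = 0 ∨ m % 4 = 1 ∨ m % 4 = 2 ∨ m % 4 = 3 := by omega
  have hn : n % 4 = 0 ∨ n % 4 = 1 ∨ n % 4 = 2 ∨ n % 4 = 3 := by omega
  have h0 := Int.emod_eq_zero_of_dvd h
  rcases hd with hd | hd <;> rcases hm with hm | hm | hm | hm <;>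
    rcases hn with hn | hn | hn | hn <;>
    simp [Int.sub_emod, Int.mul_emod, pow_two, hd, hm, hn] at h0 <;> omega

section QuadraticBasis

variable {R S : Type*} [CommRing R] [CommRing S] [Algebra R S] (b : Module.Basis (Fin 2) R S)
  {d : R}

theorem Algebra.leftMulMatrix_quadratic (h0 : b 0 = 1) (hd : b 1 ^ 2 = algebraMap R S d)
    (x y : R) :
    Algebra.leftMulMatrix b (algebraMap R S x + algebraMap R S y * b 1) = !![x, d * y; y, x] := by
  have e0 : (algebraMap R S x + algebraMap R S y * b 1) * b 0 = x • b 0 + y • b 1 := by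
    simp [Algebra.smul_def, h0]
  have e1 : (algebraMap R S x + algebraMap R S y * b 1) * b 1 = (d * y) • b 0 + x • b 1 := by
    simp only [Algebra.smul_def, h0, map_mul, ← hd]
    ring
  ext i j
  fin_cases j
  · rw [Algebra.leftMulMatrix_eq_repr_mul]
    simp only [Fin.zero_eta]
    rw [e0]
    fin_cases i <;> simp
  · rw [Algebra.leftMulMatrix_eq_repr_mul]
    simp only [Fin.mk_one]
    rw [e1]
    fin_cases i <;> simp

theorem Algebra.trace_quadratic (h0 : b 0 = 1) (hd : b 1 ^ 2 = algebraMap R S d) (x y : R) :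
    Algebra.trace R S (algebraMap R S x + algebraMap R S y * b 1) = 2 * x := by
  rw [Algebra.trace_eq_matrix_trace b, Algebra.leftMulMatrix_quadratic b h0 hd,
    Matrix.trace_fin_two_of]
  ring

theorem Algebra.norm_quadratic (h0 : b 0 = 1) (hd : b 1 ^ 2 = algebraMap R S d) (x y : R) :
    Algebra.norm R (algebraMap R S x + algebraMap R S y * b 1) = x ^ 2 - d * y ^ 2 := by
  rw [Algebra.norm_eq_matrix_det b, Algebra.leftMulMatrix_quadratic b h0 hd, Matrix.det_fin_two_of]
  ring

theorem Algebra.discr_quadratic (h0 : b 0 = 1) (hd : b 1 ^ 2 = algebraMap R S d) :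
    Algebra.discr R b = 4 * d := by
  have t0 := Algebra.trace_quadratic b h0 hd 1 0
  have t1 := Algebra.trace_quadratic b h0 hd 0 1
  have t2 := Algebra.trace_quadratic b h0 hd d 0
  simp only [map_one, map_zero, zero_mul, add_zero, zero_add, one_mul, mul_one, mul_zero]
    at t0 t1 t2
  rw [Algebra.discr_def, Matrix.det_fin_two]
  simp only [Algebra.traceMatrix_apply, Algebra.traceForm_apply, h0, mul_one, one_mul, ← sq,
    hd, t1, t2]
  simp
  rw [t0]
  ring

theorem Module.Basis.exists_eq_add_mul_of_fin_two (h0 : b 0 = 1) (z : S) :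
    ∃ x y : R, z = algebraMap R S x + algebraMap R S y * b 1 := by
  refine ⟨b.repr z 0, b.repr z 1, ?_⟩
  conv_lhs => rw [← b.sum_repr z]
  simp [Fin.sum_univ_two, h0, Algebra.smul_def]

end QuadraticBasis

namespace NumberField

variable {K : Type*} [Field K] [NumberField K]

theorem exists_int_of_isIntegral_quadratic {b : Module.Basis (Fin 2) ℚ K} {d : ℤ} (h0 : b 0 = 1)
    (hd : b 1 ^ 2 = d) (hsq : Squarefree d) (hmod : d % 4 = 2 ∨ d % 4 = 3) {z : K}
    (hz : IsIntegral ℤ z) : ∃ m n : ℤ, z = m + n * b 1 := by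
  have hd' : b 1 ^ 2 = algebraMap ℚ K d := by simpa using hd
  obtain ⟨x, y, rfl⟩ := b.exists_eq_add_mul_of_fin_two h0 z
  obtain ⟨t, ht⟩ := IsIntegrallyClosed.isIntegral_iff.mp
    (Algebra.isIntegral_trace (L := ℚ) hz)
  obtain ⟨N, hN⟩ := IsIntegrallyClosed.isIntegral_iff.mp (Algebra.isIntegral_norm ℚ hz)
  rw [Algebra.trace_quadratic b h0 hd'] at ht
  rw [Algebra.norm_quadratic b h0 hd'] at hN
  simp only [eq_intCast] at ht hN
  obtain ⟨s, hs⟩ := Rat.exists_intCast_of_squarefree_mul_sq hsq (q := 2 * y)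
    (k := t ^ 2 - 4 * N) (by push_cast; rw [ht, hN]; ring)
  have h4 : t ^ 2 - d * s ^ 2 = 4 * N := by
    have : (t : ℚ) ^ 2 - d * s ^ 2 = 4 * N := by rw [ht, hs, hN]; ring
    exact_mod_cast this
  obtain ⟨⟨m, rfl⟩, ⟨n, rfl⟩⟩ := Int.even_of_four_dvd_sq_sub_mul_sq hmod ⟨N, h4⟩
  refine ⟨m, n, ?_⟩
  push_cast at ht hs
  rw [← mul_left_cancel₀ two_ne_zero ht, ← mul_left_cancel₀ two_ne_zero hs]
  simp

/-- The integral basis `1, √d` of a quadratic field when `d` is `2` or `3` modulo `4`. -/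
theorem exists_integral_basis_quadratic {b : Module.Basis (Fin 2) ℚ K} {d : ℤ} (h0 : b 0 = 1)
    (hd : b 1 ^ 2 = d) (hsq : Squarefree d) (hmod : d % 4 = 2 ∨ d % 4 = 3) :
    ∃ c : Module.Basis (Fin 2) ℤ (𝓞 K), c 0 = 1 ∧ c 1 ^ 2 = algebraMap ℤ (𝓞 K) d := by
  have hint : IsIntegral ℤ (b 1) := by
    refine IsIntegral.of_pow two_pos ?_
    rw [hd]
    exact isIntegral_algebraMap (R := ℤ) (x := d)
  obtain ⟨θ, hθ⟩ : ∃ θ : 𝓞 K, algebraMap (𝓞 K) K θ = b 1 := ⟨⟨b 1, hint⟩, rfl⟩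
  have hli : LinearIndependent ℤ ![(1 : 𝓞 K), θ] := by
    have := b.linearIndependent.restrict_scalars' ℤ
    refine LinearIndependent.of_comp (Algebra.linearMap (𝓞 K) K |>.restrictScalars ℤ) ?_
    convert this using 1
    ext i
    fin_cases i <;> simp [h0, hθ]
  have hsp : ⊤ ≤ Submodule.span ℤ (Set.range ![(1 : 𝓞 K), θ]) := by
    intro z _
    obtain ⟨m, n, hmn⟩ := exists_int_of_isIntegral_quadratic h0 hd hsq hmod z.isIntegral_coe
    have : z = m • (1 : 𝓞 K) + n • θ := by
      apply RingOfIntegers.coe_injective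
      rw [hmn, zsmul_eq_mul, zsmul_eq_mul, mul_one, map_add, map_mul, map_intCast, map_intCast, hθ]
    rw [this]
    exact add_mem (Submodule.smul_mem _ _ (Submodule.subset_span ⟨0, rfl⟩))
      (Submodule.smul_mem _ _ (Submodule.subset_span ⟨1, rfl⟩))
  refine ⟨Module.Basis.mk hli hsp, by simp, ?_⟩
  ext
  simp [hθ, hd]

end NumberField

theorem IntermediateField.exists_basis_adjoin_sqrt {L : Type*} [Field L] [CharZero L] {α : L}
    {d : ℤ} (hα : α ^ 2 = d) (hsq : Squarefree d) (hd : d ≠ 1) :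
    ∃ b : Module.Basis (Fin 2) ℚ ℚ⟮α⟯, b 0 = 1 ∧ b 1 ^ 2 = d := by
  have hirr : Irreducible (X ^ 2 - C (d : ℚ)) := by
    refine X_pow_sub_C_irreducible_of_prime Nat.prime_two fun r hr ↦ hd ?_
    obtain ⟨n, rfl⟩ := Rat.exists_intCast_of_squarefree_mul_sq (d := 1) squarefree_one
      (q := r) (k := d) (by simpa using hr)
    have hn : n ^ 2 = d := by exact_mod_cast hr
    have hu : IsUnit n := hsq n ⟨1, by rw [← hn]; ring⟩
    rcases Int.isUnit_iff.mp hu with rfl | rfl <;> simp [← hn]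
  have hmin : minpoly ℚ α = X ^ 2 - C (d : ℚ) :=
    (minpoly.eq_of_irreducible_of_monic hirr (by simp [hα]) (by monicity!)).symm
  have hint : IsIntegral ℚ α := ⟨X ^ 2 - C (d : ℚ), by monicity!, by simp [← aeval_def, hα]⟩
  have hdim : (adjoin.powerBasis hint).dim = 2 := by
    rw [adjoin.powerBasis_dim, hmin, natDegree_X_pow_sub_C]
  refine ⟨(adjoin.powerBasis hint).basis.reindex (finCongr hdim), by simp, ?_⟩
  ext
  simp [hα]

namespace NumberField

open scoped nonZeroDivisors

variable {K : Type*} [Field K] [NumberField K]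

/-- Minkowski's bound for quadratic fields of discriminant `56` or `-56`. -/
theorem exists_ideal_in_class_absNorm_le_four (hK : Module.finrank ℚ K = 2)
    (hdisc : |discr K| = 56) (C : ClassGroup (𝓞 K)) :
    ∃ I : (Ideal (𝓞 K))⁰, ClassGroup.mk0 I = C ∧ Ideal.absNorm (I : Ideal (𝓞 K)) ≤ 4 := by
  obtain ⟨I, hI, hle⟩ := exists_ideal_in_class_of_norm_le C
  refine ⟨I, hI, Nat.lt_succ_iff.mp ?_⟩
  have hr : InfinitePlace.nrComplexPlaces K ≤ 1 := by
    have := InfinitePlace.card_add_two_mul_card_eq_rank K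
    omega
  have hpi := Real.pi_gt_d2
  have hs : √(56 : ℝ) < 7.5 := (Real.sqrt_lt' (by norm_num)).mpr (by norm_num)
  have hp : (4 / Real.pi) ^ InfinitePlace.nrComplexPlaces K < (1.28 : ℝ) := by
    have h4 : 4 / Real.pi < 1.28 := by
      rw [div_lt_iff₀ (by positivity)]
      linarith
    interval_cases InfinitePlace.nrComplexPlaces K
    · norm_num
    · simpa using h4
  rw [hK, ← Int.cast_abs, hdisc] at hle
  norm_num [Nat.factorial] at hle
  have : (Ideal.absNorm (I : Ideal (𝓞 K)) : ℝ) < 5 := by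
    refine hle.trans_lt ?_
    have := mul_lt_mul'' hp hs (by positivity) (by positivity)
    linarith
  exact_mod_cast this

/-- The class group is generated by the classes of prime ideals of norm at most `4`. -/
theorem classGroup_eq_top_of_prime_mem (hK : Module.finrank ℚ K = 2) (hdisc : |discr K| = 56)
    (H : Subgroup (ClassGroup (𝓞 K)))
    (h : ∀ P : (Ideal (𝓞 K))⁰, (P : Ideal (𝓞 K)).IsPrime →
      Ideal.absNorm (P : Ideal (𝓞 K)) ≤ 4 → ClassGroup.mk0 P ∈ H) : H = ⊤ := by
  refine (Subgroup.eq_top_iff' H).mpr fun C ↦ ?_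
  obtain ⟨⟨I, hI0⟩, rfl, hI⟩ := exists_ideal_in_class_absNorm_le_four hK hdisc C
  induction I using UniqueFactorizationMonoid.induction_on_prime with
  | h₁ => exact absurd rfl (nonZeroDivisors.ne_zero hI0)
  | h₂ x hx =>
    have : (⟨x, hI0⟩ : (Ideal (𝓞 K))⁰) = 1 := Subtype.ext (by simpa using hx)
    rw [this, map_one]
    exact one_mem H
  | h₃ J P hJ hP ih =>
    have hP0 : P ∈ (Ideal (𝓞 K))⁰ := mem_nonZeroDivisors_of_ne_zero hP.ne_zero
    have hJ0 : J ∈ (Ideal (𝓞 K))⁰ := mem_nonZeroDivisors_of_ne_zero hJ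
    have hPn := Ideal.absNorm_pos_of_nonZeroDivisors ⟨P, hP0⟩
    have hJn := Ideal.absNorm_pos_of_nonZeroDivisors ⟨J, hJ0⟩
    simp only [map_mul] at hI hPn hJn
    have : (⟨P * J, hI0⟩ : (Ideal (𝓞 K))⁰) = ⟨P, hP0⟩ * ⟨J, hJ0⟩ := rfl
    rw [this, map_mul]
    exact mul_mem (h ⟨P, hP0⟩ (Ideal.isPrime_of_prime hP) (by nlinarith))
      (ih hJ0 (by nlinarith))

end NumberField

namespace Ideal

variable {S : Type*} [CommRing S] [IsDedekindDomain S] [Module.Free ℤ S] [Module.Finite ℤ S]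

theorem eq_of_le_of_prime_absNorm {J P : Ideal S} (hJ : (absNorm J).Prime) (hJP : J ≤ P)
    (hP : P.IsPrime) : J = P := by
  have hJ0 : J ≠ ⊥ := by
    rintro rfl
    simp [Nat.not_prime_zero] at hJ
  exact ((isPrime_of_irreducible_absNorm hJ).isMaximal hJ0).eq_of_le hP.ne_top hJP

theorem IsPrime.two_mem_or_three_mem_of_absNorm_le_four {P : Ideal S} (hP : P.IsPrime)
    (h0 : P ≠ ⊥) [Infinite S] (h : absNorm P ≤ 4) :
    (2 : S) ∈ P ∨ ((3 : S) ∈ P ∧ absNorm P = 3) := by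
  have hmem := absNorm_mem P
  have h0' : absNorm P ≠ 0 := absNorm_eq_zero_iff.not.mpr h0
  have h1 : absNorm P ≠ 1 := absNorm_eq_one_iff.not.mpr hP.ne_top
  interval_cases absNorm P
  · exact absurd rfl h0'
  · exact absurd rfl h1
  · exact Or.inl (by simpa using hmem)
  · exact Or.inr ⟨by simpa using hmem, rfl⟩
  · refine Or.inl (hP.mem_of_pow_mem 2 ?_)
    norm_num
    simpa using hmem

end Ideal

theorem ClassGroup.mk0_mul_mk0_eq_one {R : Type*} [CommRing R] [IsDedekindDomain R]
    {I J : (nonZeroDivisors (Ideal R))} {x : R} (h : (I : Ideal R) * J = Ideal.span {x}) :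
    ClassGroup.mk0 I * ClassGroup.mk0 J = 1 := by
  rw [← map_mul, ClassGroup.mk0_eq_one_iff]
  rw [Submonoid.coe_mul, h]
  exact ⟨x, rfl⟩

namespace NumberField

open scoped nonZeroDivisors

variable {K : Type*} [Field K] [NumberField K]

theorem finrank_eq_two_of_basis (c : Module.Basis (Fin 2) ℤ (𝓞 K)) :
    Module.finrank ℚ K = 2 := by
  rw [← RingOfIntegers.rank, Module.finrank_eq_card_basis c, Fintype.card_fin]

theorem absNorm_span_quadratic (c : Module.Basis (Fin 2) ℤ (𝓞 K)) {d : ℤ}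
    (h0 : c 0 = 1) (hd : c 1 ^ 2 = algebraMap ℤ (𝓞 K) d) (m n : ℤ) :
    Ideal.absNorm (Ideal.span {(m : 𝓞 K) + n * c 1}) = (m ^ 2 - d * n ^ 2).natAbs := by
  rw [Ideal.absNorm_span_singleton, ← Algebra.norm_quadratic c h0 hd m n]
  simp

theorem isPrincipalIdealRing_of_basis_sqrt_fourteen (c : Module.Basis (Fin 2) ℤ (𝓞 K))
    (h0 : c 0 = 1) (hd : c 1 ^ 2 = algebraMap ℤ (𝓞 K) 14) : IsPrincipalIdealRing (𝓞 K) := by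
  have hdisc : |discr K| = 56 := by
    rw [← discr_eq_discr K c, Algebra.discr_quadratic c h0 hd]
    norm_num
  have hnorm := absNorm_span_quadratic c h0 hd 4 1
  obtain ⟨θ, hθ⟩ : ∃ θ, c 1 = θ := ⟨_, rfl⟩
  rw [hθ] at hnorm hd
  replace hd : θ ^ 2 = 14 := by simpa using hd
  norm_num [-Ideal.absNorm_span_singleton] at hnorm
  have htop := classGroup_eq_top_of_prime_mem (finrank_eq_two_of_basis c) hdisc ⊥ ?_
  · rw [← classNumber_eq_one_iff, classNumber, Fintype.card_eq_one_iff]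
    exact ⟨1, fun C ↦ Subgroup.mem_bot.mp (htop ▸ Subgroup.mem_top C)⟩
  rintro ⟨P, hP0⟩ hP hle
  rw [Subgroup.mem_bot, ClassGroup.mk0_eq_one_iff]
  dsimp only at hP hle
  rcases hP.two_mem_or_three_mem_of_absNorm_le_four (nonZeroDivisors.ne_zero hP0) hle with
    h2 | ⟨h3, hN⟩
  · have hθP : θ ∈ P := by
      refine hP.mem_of_pow_mem 2 ?_
      rw [hd, show (14 : 𝓞 K) = 7 * 2 by norm_num]
      exact P.mul_mem_left _ h2
    have : Ideal.span {4 + θ} = P := by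
      refine Ideal.eq_of_le_of_prime_absNorm (by rw [hnorm]; exact Nat.prime_two) ?_ hP
      rw [Ideal.span_singleton_le_iff_mem, show (4 : 𝓞 K) = 2 * 2 by norm_num]
      exact P.add_mem (P.mul_mem_left _ h2) hθP
    exact ⟨4 + θ, this.symm⟩
  · exfalso
    -- In the field with three elements `θ ^ 3 = θ`, whereas `14` is not a square modulo `3`.
    have : P.IsMaximal := hP.isMaximal (nonZeroDivisors.ne_zero hP0)
    let := Ideal.Quotient.field P
    have hcard : Nat.card (𝓞 K ⧸ P) = 3 := by
      rw [← hN, Ideal.absNorm_apply, Submodule.cardQuot_apply]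
    have : Finite (𝓞 K ⧸ P) := Nat.finite_of_card_ne_zero (by omega)
    let := Fintype.ofFinite (𝓞 K ⧸ P)
    have hpow := FiniteField.pow_card (Ideal.Quotient.mk P θ)
    rw [← Nat.card_eq_fintype_card, hcard, ← map_pow, Ideal.Quotient.eq] at hpow
    have hθP : θ ∈ P := by
      have : θ = 13 * θ - 3 * (4 * θ) := by ring
      rw [this]
      refine P.sub_mem ?_ (P.mul_mem_right _ h3)
      convert hpow using 1
      linear_combination (-θ) * hd
    have h14 : (14 : 𝓞 K) ∈ P := hd ▸ P.pow_mem_of_mem hθP 2 two_pos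
    refine hP.ne_top (P.eq_top_iff_one.mpr ?_)
    rw [show (1 : 𝓞 K) = 3 * 5 - 14 by norm_num]
    exact P.sub_mem (P.mul_mem_right _ h3) h14

theorem nonempty_classGroup_mulEquiv_of_basis_sqrt_neg_fourteen
    (c : Module.Basis (Fin 2) ℤ (𝓞 K)) (h0 : c 0 = 1)
    (hd : c 1 ^ 2 = algebraMap ℤ (𝓞 K) (-14)) :
    Nonempty (ClassGroup (𝓞 K) ≃* Multiplicative (ZMod 4)) := by
  have hdisc : |discr K| = 56 := by
    rw [← discr_eq_discr K c, Algebra.discr_quadratic c h0 hd]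
    norm_num
  have hnorm := absNorm_span_quadratic c h0 hd
  have hbasis := c.exists_eq_add_mul_of_fin_two h0
  obtain ⟨θ, hθ⟩ : ∃ θ, c 1 = θ := ⟨_, rfl⟩
  simp only [hθ] at hnorm hd hbasis
  replace hd : θ ^ 2 = -14 := by simpa using hd
  have key2 : Ideal.span {2, θ} * Ideal.span {2, θ} = Ideal.span {(2 : 𝓞 K)} := by
    rw [Ideal.span_pair_mul_span_pair]
    refine le_antisymm (Ideal.span_le.mpr ?_) ((Ideal.span_singleton_le_iff_mem _).mpr ?_)
    · rintro _ (rfl | rfl | rfl | rfl) <;> rw [SetLike.mem_coe, Ideal.mem_span_singleton']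
      exacts [⟨2, rfl⟩, ⟨θ, by ring⟩, ⟨θ, by ring⟩, ⟨-7, by linear_combination -hd⟩]
    · simp only [Ideal.mem_span_insert, Ideal.mem_span_singleton']
      exact ⟨4, _, ⟨0, _, ⟨0, _, ⟨1, rfl⟩, rfl⟩, rfl⟩, by linear_combination -hd⟩
  have key3 : Ideal.span {3, θ - 1} * Ideal.span {3, θ + 1} = Ideal.span {(3 : 𝓞 K)} := by
    rw [Ideal.span_pair_mul_span_pair]
    refine le_antisymm (Ideal.span_le.mpr ?_) ((Ideal.span_singleton_le_iff_mem _).mpr ?_)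
    · rintro _ (rfl | rfl | rfl | rfl) <;> rw [SetLike.mem_coe, Ideal.mem_span_singleton']
      exacts [⟨3, rfl⟩, ⟨θ + 1, by ring⟩, ⟨θ - 1, by ring⟩, ⟨-5, by linear_combination -hd⟩]
    · simp only [Ideal.mem_span_insert, Ideal.mem_span_singleton']
      exact ⟨2, _, ⟨0, _, ⟨0, _, ⟨1, rfl⟩, rfl⟩, rfl⟩, by linear_combination -hd⟩
  have key9 : Ideal.span {3, θ - 1} * Ideal.span {3, θ - 1} = Ideal.span {9, θ + 2} := by
    rw [Ideal.span_pair_mul_span_pair]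
    refine le_antisymm (Ideal.span_le.mpr ?_) (Ideal.span_le.mpr ?_)
    · rintro _ (rfl | rfl | rfl | rfl) <;> rw [SetLike.mem_coe, Ideal.mem_span_pair]
      exacts [⟨1, 0, by ring⟩, ⟨-1, 3, by ring⟩, ⟨-1, 3, by ring⟩,
        ⟨-1, -2, by linear_combination -hd⟩]
    · rintro _ (rfl | rfl) <;>
        simp only [SetLike.mem_coe, Ideal.mem_span_insert, Ideal.mem_span_singleton']
      · exact ⟨1, _, ⟨0, _, ⟨0, _, ⟨0, rfl⟩, rfl⟩, rfl⟩, by ring⟩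
      · exact ⟨2, _, ⟨1, _, ⟨0, _, ⟨1, rfl⟩, rfl⟩, rfl⟩, by linear_combination -hd⟩
  have key18 : Ideal.span {2, θ} * (Ideal.span {3, θ - 1} * Ideal.span {3, θ - 1}) =
      Ideal.span {2 + θ} := by
    rw [key9, Ideal.span_pair_mul_span_pair]
    refine le_antisymm (Ideal.span_le.mpr ?_) ((Ideal.span_singleton_le_iff_mem _).mpr ?_)
    · rintro _ (rfl | rfl | rfl | rfl) <;> rw [SetLike.mem_coe, Ideal.mem_span_singleton']
      exacts [⟨2 - θ, by linear_combination -hd⟩, ⟨2, by ring⟩,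
        ⟨θ + 7, by linear_combination hd⟩, ⟨θ, by ring⟩]
    · simp only [Ideal.mem_span_insert, Ideal.mem_span_singleton']
      exact ⟨1, _, ⟨-4, _, ⟨1, _, ⟨0, rfl⟩, rfl⟩, rfl⟩, by ring⟩
  have norm2 : Ideal.absNorm (Ideal.span {2, θ}) = 2 := by
    have h := congrArg Ideal.absNorm key2
    have h' := hnorm 2 0
    norm_num [-Ideal.absNorm_span_singleton] at h'
    rw [h', map_mul] at h
    nlinarith
  have norm3 : Ideal.absNorm (Ideal.span {3, θ - 1}) = 3 := by
    have h := congrArg Ideal.absNorm key18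
    have h' := hnorm 2 1
    norm_num [-Ideal.absNorm_span_singleton] at h'
    rw [h', map_mul, map_mul, norm2] at h
    nlinarith
  have norm3' : Ideal.absNorm (Ideal.span {3, θ + 1}) = 3 := by
    have h := congrArg Ideal.absNorm key3
    have h' := hnorm 3 0
    norm_num [-Ideal.absNorm_span_singleton] at h'
    rw [h', map_mul, norm3] at h
    omega
  have ne_zero {I : Ideal (𝓞 K)} (h : Ideal.absNorm I ≠ 0) : I ∈ (Ideal (𝓞 K))⁰ :=
    mem_nonZeroDivisors_of_ne_zero fun h' ↦ h (by simp [h'])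
  let P₂ : (Ideal (𝓞 K))⁰ := ⟨_, ne_zero (norm2.trans_ne two_ne_zero)⟩
  let P₃ : (Ideal (𝓞 K))⁰ := ⟨_, ne_zero (norm3.trans_ne three_ne_zero)⟩
  let P₃' : (Ideal (𝓞 K))⁰ := ⟨_, ne_zero (norm3'.trans_ne three_ne_zero)⟩
  have rel2 : ClassGroup.mk0 P₂ * ClassGroup.mk0 P₂ = 1 := ClassGroup.mk0_mul_mk0_eq_one key2
  have rel3 : ClassGroup.mk0 P₃ * ClassGroup.mk0 P₃' = 1 := ClassGroup.mk0_mul_mk0_eq_one key3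
  have rel18 : ClassGroup.mk0 P₂ * ClassGroup.mk0 (P₃ * P₃) = 1 :=
    ClassGroup.mk0_mul_mk0_eq_one key18
  rw [map_mul, ← sq] at rel18
  have not_principal : ClassGroup.mk0 P₂ ≠ 1 := by
    rw [Ne, ClassGroup.mk0_eq_one_iff]
    rintro ⟨z, hz⟩
    obtain ⟨m, n, rfl⟩ := hbasis z
    have h := norm2
    change Ideal.span {2, θ} = Ideal.span _ at hz
    rw [hz] at h
    have h' := (hnorm m n).symm.trans h
    have : m ^ 2 + 14 * n ^ 2 = 2 := by
      have : (0 : ℤ) ≤ m ^ 2 - -14 * n ^ 2 := by nlinarith [sq_nonneg m, sq_nonneg n]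
      omega
    have hn : n = 0 := by nlinarith [sq_nonneg m, sq_nonneg n]
    subst hn
    have hm : m ≤ 1 := by nlinarith
    have hm' : -1 ≤ m := by nlinarith
    interval_cases m <;> omega
  have hzpow : Subgroup.zpowers (ClassGroup.mk0 P₃) = ⊤ := by
    refine classGroup_eq_top_of_prime_mem (finrank_eq_two_of_basis c) hdisc _ ?_
    rintro ⟨P, hP0⟩ hP hle
    dsimp only at hP hle
    rcases hP.two_mem_or_three_mem_of_absNorm_le_four (nonZeroDivisors.ne_zero hP0) hle with
      h2 | ⟨h3, -⟩
    · have hθP : θ ∈ P := by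
        refine hP.mem_of_pow_mem 2 ?_
        rw [hd, show (-14 : 𝓞 K) = -7 * 2 by norm_num]
        exact P.mul_mem_left _ h2
      have : P₂ = ⟨P, hP0⟩ := Subtype.ext <|
        Ideal.eq_of_le_of_prime_absNorm (norm2.symm ▸ Nat.prime_two)
          (Ideal.span_le.mpr (by rintro _ (rfl | rfl) <;> assumption)) hP
      rw [← this, eq_inv_of_mul_eq_one_left rel18]
      exact inv_mem (pow_mem (Subgroup.mem_zpowers _) 2)
    · have hprod : (θ - 1) * (θ + 1) ∈ P := by
        rw [show (θ - 1) * (θ + 1) = 3 * (-5) by linear_combination hd]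
        exact P.mul_mem_right _ h3
      rcases hP.mem_or_mem hprod with hm | hm
      · have : P₃ = ⟨P, hP0⟩ := Subtype.ext <|
          Ideal.eq_of_le_of_prime_absNorm (norm3.symm ▸ Nat.prime_three)
            (Ideal.span_le.mpr (by rintro _ (rfl | rfl) <;> assumption)) hP
        rw [← this]
        exact Subgroup.mem_zpowers _
      · have : P₃' = ⟨P, hP0⟩ := Subtype.ext <|
          Ideal.eq_of_le_of_prime_absNorm (norm3'.symm ▸ Nat.prime_three)
            (Ideal.span_le.mpr (by rintro _ (rfl | rfl) <;> assumption)) hP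
        rw [← this, eq_inv_of_mul_eq_one_right rel3]
        exact inv_mem (Subgroup.mem_zpowers _)
  have horder : orderOf (ClassGroup.mk0 P₃) = 4 := by
    refine orderOf_eq_prime_pow (p := 2) (n := 1) (fun h ↦ not_principal ?_) ?_
    · rwa [pow_one, eq_inv_of_mul_eq_one_right rel18, inv_eq_one] at h
    · rw [show 2 ^ (1 + 1) = 2 * 2 from rfl, pow_mul, eq_inv_of_mul_eq_one_right rel18, inv_pow, sq,
        rel2, inv_one]
  have hcard : Nat.card (ClassGroup (𝓞 K)) = 4 := by
    rw [← Subgroup.card_top, ← hzpow, Nat.card_zpowers, horder]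
  have : IsCyclic (ClassGroup (𝓞 K)) :=
    ⟨_, fun x ↦ hzpow.symm ▸ Subgroup.mem_top x⟩
  exact ⟨hcard ▸ (zmodCyclicMulEquiv inferInstance).symm⟩

end NumberField

/-- The ring of integers of the real quadratic field `ℚ(√14)` is a principal ideal
domain (equivalently, the class number of `ℚ(√14)` is `1`), while the ideal class
group of the ring of integers of the imaginary quadratic field `ℚ(√-14)` is
isomorphic to `ℤ/4ℤ`. -/
theorem ringOfIntegers_sqrt14_pid_and_classGroup_sqrt_neg14 :
    IsPrincipalIdealRing (𝓞 ℚ⟮Real.sqrt (14 : ℕ)⟯) ∧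
    NumberField.classNumber ℚ⟮Real.sqrt (14 : ℕ)⟯ = 1 ∧
    Nonempty (ClassGroup (𝓞 ℚ⟮(Real.sqrt (14 : ℕ) : ℂ) * Complex.I⟯) ≃*
      Multiplicative (ZMod 4)) := by
  have hsq : Squarefree (14 : ℤ) := by
    rw [← Int.squarefree_natAbs]
    exact (Nat.squarefree_mul (m := 2) (n := 7) (by norm_num)).mpr
      ⟨Nat.prime_two.squarefree, (by norm_num : Nat.Prime 7).squarefree⟩
  have hsq' : Squarefree (-14 : ℤ) := by
    rwa [← Int.squarefree_natAbs, Int.natAbs_neg, Int.squarefree_natAbs]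
  have hreal : IsPrincipalIdealRing (𝓞 ℚ⟮Real.sqrt (14 : ℕ)⟯) := by
    obtain ⟨b, hb0, hb1⟩ := exists_basis_adjoin_sqrt (α := Real.sqrt (14 : ℕ)) (d := 14)
      (by rw [Real.sq_sqrt (by positivity)]; norm_num) hsq (by norm_num)
    obtain ⟨c, hc0, hc1⟩ := exists_integral_basis_quadratic hb0 hb1 hsq (by norm_num)
    exact isPrincipalIdealRing_of_basis_sqrt_fourteen c hc0 hc1
  refine ⟨hreal, classNumber_eq_one_iff.mpr hreal, ?_⟩
  obtain ⟨b, hb0, hb1⟩ := exists_basis_adjoin_sqrt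
    (α := (Real.sqrt (14 : ℕ) : ℂ) * Complex.I) (d := -14)
    (by rw [mul_pow, Complex.I_sq, ← Complex.ofReal_pow, Real.sq_sqrt (by positivity)]; norm_num)
    hsq' (by norm_num)
  obtain ⟨c, hc0, hc1⟩ := exists_integral_basis_quadratic hb0 hb1 hsq' (by norm_num)
  exact nonempty_classGroup_mulEquiv_of_basis_sqrt_neg_fourteen c hc0 hc1
end

section
/- Let O be the ring of integers of the real quadratic field ℚ(√14) and let R = ℤ + 8·O be the order of conductor 8 in ℚ(√14). Then the class group of R (invertible fractional R-ideals modulo principal ones) is isomorphic to ℤ/4ℤ, and hence is isomorphic to the ideal class group of the ring of integers of ℚ(√-14). -/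
open NumberField IntermediateField Polynomial

/-- The order `ℤ + f·O_K` of conductor `f` in a number field `K`, as a subring of the
ring of integers `O_K`. -/
def conductorOrder (K : Type*) [Field K] [NumberField K] (f : ℕ) : Subring (𝓞 K) where
  carrier := {x | ∃ (a : ℤ) (y : 𝓞 K), x = (a : 𝓞 K) + (f : 𝓞 K) * y}
  zero_mem' := ⟨0, 0, by simp⟩
  one_mem' := ⟨1, 0, by simp⟩
  add_mem' := by
    rintro _ _ ⟨a, y, rfl⟩ ⟨b, z, rfl⟩
    exact ⟨a + b, y + z, by push_cast; ring⟩
  neg_mem' := by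
    rintro _ ⟨a, y, rfl⟩
    exact ⟨-a, -y, by push_cast; ring⟩
  mul_mem' := by
    rintro _ _ ⟨a, y, rfl⟩ ⟨b, z, rfl⟩
    exact ⟨a * b, (a : 𝓞 K) * z + (b : 𝓞 K) * y + (f : 𝓞 K) * (y * z), by push_cast; ring⟩

open scoped nonZeroDivisors

section IdealClasses

variable {R : Type*} [CommRing R] [IsDomain R]

/-- The integral ideal `J` is invertible and its class is `C`. -/
def RepresentsClass (J : Ideal R) (C : ClassGroup R) : Prop :=
  ∃ I : (FractionalIdeal R⁰ (FractionRing R))ˣ,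
    (I : FractionalIdeal R⁰ (FractionRing R)) = J ∧ ClassGroup.mk (FractionRing R) I = C

theorem isUnit_coeIdeal_span_singleton {x : R} (hx : x ≠ 0) :
    IsUnit ((Ideal.span {x} : Ideal R) : FractionalIdeal R⁰ (FractionRing R)) := by
  have hx' : algebraMap R (FractionRing R) x ≠ 0 := by simpa using hx
  refine ⟨toPrincipalIdeal R (FractionRing R) (Units.mk0 _ hx'), ?_⟩
  rw [coe_toPrincipalIdeal, FractionalIdeal.coeIdeal_span_singleton, Units.val_mk0]

namespace RepresentsClass

theorem eq_class {J : Ideal R} {C C' : ClassGroup R} (h : RepresentsClass J C)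
    (h' : RepresentsClass J C') : C = C' := by
  obtain ⟨I, hI, rfl⟩ := h
  obtain ⟨I', hI', rfl⟩ := h'
  rw [Units.ext (hI.trans hI'.symm)]

theorem of_span_mul_eq {J J' : Ideal R} {C : ClassGroup R} (h : RepresentsClass J C) {x y : R}
    (hx : x ≠ 0) (hy : y ≠ 0) (hxy : Ideal.span {x} * J = Ideal.span {y} * J') :
    RepresentsClass J' C := by
  obtain ⟨I, hI, rfl⟩ := h
  have hu : IsUnit (J' : FractionalIdeal R⁰ (FractionRing R)) := by
    refine isUnit_of_mul_isUnit_right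
      (x := ((Ideal.span {y} : Ideal R) : FractionalIdeal R⁰ (FractionRing R))) ?_
    rw [← FractionalIdeal.coeIdeal_mul, ← hxy, FractionalIdeal.coeIdeal_mul, ← hI]
    exact (isUnit_coeIdeal_span_singleton hx).mul I.isUnit
  exact ⟨hu.unit, rfl,
    (ClassGroup.mk_eq_mk_of_coe_ideal rfl hI).2 ⟨y, x, hy, hx, hxy.symm⟩⟩

theorem mul {J J' : Ideal R} {C C' : ClassGroup R} (h : RepresentsClass J C)
    (h' : RepresentsClass J' C') : RepresentsClass (J * J') (C * C') := by
  obtain ⟨I, hI, rfl⟩ := h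
  obtain ⟨I', hI', rfl⟩ := h'
  exact ⟨I * I', by rw [Units.val_mul, hI, hI', FractionalIdeal.coeIdeal_mul], map_mul _ _ _⟩

theorem one_iff {J : Ideal R} :
    RepresentsClass J 1 ↔ ∃ x : R, x ≠ 0 ∧ J = Ideal.span {x} := by
  constructor
  · rintro ⟨I, hI, h⟩
    exact (ClassGroup.mk_eq_one_of_coe_ideal hI).1 h
  · rintro ⟨x, hx, rfl⟩
    exact ⟨(isUnit_coeIdeal_span_singleton hx).unit, rfl,
      (ClassGroup.mk_eq_one_of_coe_ideal rfl).2 ⟨x, hx, rfl⟩⟩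

theorem exists_of_mul_eq_span {J J' : Ideal R} {x : R} (hx : x ≠ 0)
    (h : J * J' = Ideal.span {x}) :
    ∃ C : ClassGroup R, RepresentsClass J C ∧ RepresentsClass J' C⁻¹ := by
  have hu := isUnit_coeIdeal_span_singleton hx
  rw [← h, FractionalIdeal.coeIdeal_mul] at hu
  have hJ : RepresentsClass J _ := ⟨(isUnit_of_mul_isUnit_left hu).unit, rfl, rfl⟩
  have hJ' : RepresentsClass J' _ := ⟨(isUnit_of_mul_isUnit_right hu).unit, rfl, rfl⟩
  refine ⟨_, hJ, ?_⟩
  rw [← eq_inv_of_mul_eq_one_right ((hJ.mul hJ').eq_class (one_iff.2 ⟨x, hx, h⟩))]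
  exact hJ'

theorem exists_ideal (C : ClassGroup R) : ∃ J : Ideal R, J ≠ ⊥ ∧ RepresentsClass J C := by
  refine ClassGroup.induction (FractionRing R) (fun I => ?_) C
  have hu := FractionalIdeal.isUnit_num.2 I.isUnit
  refine ⟨(I : FractionalIdeal R⁰ (FractionRing R)).num, ?_, hu.unit, rfl, ?_⟩
  · rw [← FractionalIdeal.coeIdeal_ne_zero (K := FractionRing R)]
    exact hu.ne_zero
  · have hd : algebraMap R (FractionRing R)
        (I : FractionalIdeal R⁰ (FractionRing R)).den ≠ 0 :=
      IsFractionRing.to_map_ne_zero_of_mem_nonZeroDivisors (SetLike.coe_mem _)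
    refine (ClassGroup.mk_eq_mk.2 ⟨Units.mk0 _ hd, Units.ext ?_⟩).symm
    rw [mul_comm, Units.val_mul, coe_toPrincipalIdeal, Units.val_mk0]
    exact FractionalIdeal.den_mul_self_eq_num' R⁰ (FractionRing R) I

/-- An invertible ideal has multiplier ring `R`. -/
theorem dvd_of_span_mul_le {J : Ideal R} {C : ClassGroup R} (h : RepresentsClass J C) {x y : R}
    (hxy : Ideal.span {x} * J ≤ Ideal.span {y} * J) : y ∣ x := by
  obtain ⟨I, hI, -⟩ := h
  rw [← FractionalIdeal.coeIdeal_le_coeIdeal (FractionRing R), FractionalIdeal.coeIdeal_mul,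
    FractionalIdeal.coeIdeal_mul, ← hI] at hxy
  have key := mul_le_mul_left hxy (↑I⁻¹ : FractionalIdeal R⁰ (FractionRing R))
  rwa [mul_assoc, mul_assoc, Units.mul_inv, mul_one, mul_one,
    FractionalIdeal.coeIdeal_le_coeIdeal, Ideal.span_singleton_le_span_singleton] at key

end RepresentsClass

end IdealClasses

/-- `1, θ` is a `ℤ`-basis of `R` and `θ ^ 2 = d`. -/
structure IsQuadraticGenerator {R : Type*} [CommRing R] (d : ℤ) (θ : R) : Prop where
  sq : θ ^ 2 = d
  exists_eq : ∀ z : R, ∃ x y : ℤ, z = x + y * θ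
  eq_zero : ∀ x y : ℤ, (x : R) + y * θ = 0 → x = 0 ∧ y = 0

/-- The ideal generated by `a` and `b + θ`. -/
def formIdeal {R : Type*} [CommRing R] (θ : R) (a b : ℤ) : Ideal R :=
  Ideal.span {(a : R), (b : R) + θ}

theorem formIdeal_neg {R : Type*} [CommRing R] (θ : R) (a b : ℤ) :
    formIdeal θ (-a) b = formIdeal θ a b := by
  simp [formIdeal, Ideal.span_insert]

theorem formIdeal_add_mul {R : Type*} [CommRing R] (θ : R) (a b k : ℤ) :
    formIdeal θ a (b + k * a) = formIdeal θ a b := by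
  rw [formIdeal, formIdeal, ← Ideal.span_pair_add_mul_left (x := (a : R)) (y := b + θ) (z := k)]
  push_cast
  ring_nf

namespace IsQuadraticGenerator

variable {R : Type*} [CommRing R] {d : ℤ} {θ : R}

theorem formIdeal_mul (h : IsQuadraticGenerator d θ) {a₁ a₂ b : ℤ} (c u v w : ℤ)
    (hc : a₁ * a₂ * c = b ^ 2 - d) (hb : u * a₁ + v * a₂ + w * (2 * b) = 1) :
    formIdeal θ a₁ b * formIdeal θ a₂ b = formIdeal θ (a₁ * a₂) b := by
  have hsq := h.sq
  have hc' : (a₁ * a₂ * c : R) = b ^ 2 - d := by exact_mod_cast congrArg (Int.cast : ℤ → R) hc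
  have hb' : (u * a₁ + v * a₂ + w * (2 * b) : R) = 1 := by
    exact_mod_cast congrArg (Int.cast : ℤ → R) hb
  rw [formIdeal, formIdeal, formIdeal, Ideal.span_pair_mul_span_pair]
  apply le_antisymm
  · rw [Ideal.span_le]
    rintro z (rfl | rfl | rfl | rfl) <;> rw [SetLike.mem_coe, Ideal.mem_span_pair]
    · exact ⟨1, 0, by push_cast; ring⟩
    · exact ⟨0, a₁, by ring⟩
    · exact ⟨0, a₂, by ring⟩
    · exact ⟨-c, 2 * b, by push_cast; linear_combination -hc' - hsq⟩
  · rw [Ideal.span_le]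
    rintro z (rfl | rfl)
    · exact Ideal.subset_span (by simp)
    · have e : (b + θ : R) = u * (a₁ * (b + θ)) + v * ((b + θ) * a₂) +
          w * ((b + θ) * (b + θ) + c * (a₁ * a₂)) := by
        linear_combination -(b + θ : R) * hb' - (w : R) * hc' - (w : R) * hsq
      refine Set.mem_of_eq_of_mem e ?_
      rw [SetLike.mem_coe]
      refine add_mem (add_mem ?_ ?_) ?_
      · exact Ideal.mul_mem_left _ _ (Ideal.subset_span (by simp))
      · exact Ideal.mul_mem_left _ _ (Ideal.subset_span (by simp))
      · exact Ideal.mul_mem_left _ _ (add_mem (Ideal.subset_span (by simp))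
          (Ideal.mul_mem_left _ _ (Ideal.subset_span (by simp))))

theorem formIdeal_mul_conj (h : IsQuadraticGenerator d θ) {a b : ℤ} (c u v w : ℤ)
    (hc : a * c = b ^ 2 - d) (hb : u * a + v * (2 * b) + w * c = 1) :
    formIdeal θ a b * formIdeal θ a (-b) = Ideal.span {(a : R)} := by
  have hsq := h.sq
  have hc' : (a * c : R) = b ^ 2 - d := by exact_mod_cast congrArg (Int.cast : ℤ → R) hc
  have hb' : (u * a + v * (2 * b) + w * c : R) = 1 := by
    exact_mod_cast congrArg (Int.cast : ℤ → R) hb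
  rw [formIdeal, formIdeal, Ideal.span_pair_mul_span_pair]
  apply le_antisymm
  · rw [Ideal.span_le]
    rintro z (rfl | rfl | rfl | rfl) <;> rw [SetLike.mem_coe, Ideal.mem_span_singleton']
    · exact ⟨a, by ring⟩
    · exact ⟨-b + θ, by push_cast; ring⟩
    · exact ⟨b + θ, by ring⟩
    · exact ⟨-c, by push_cast; linear_combination -hc' - hsq⟩
  · rw [Ideal.span_le]
    rintro z rfl
    have e : (a : R) = u * (a * a) + v * ((b + θ) * a - a * ((-b : ℤ) + θ)) +
        (-w) * ((b + θ) * ((-b : ℤ) + θ)) := by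
      push_cast
      linear_combination -(a : R) * hb' + (w : R) * hc' + (w : R) * hsq
    refine Set.mem_of_eq_of_mem e ?_
    rw [SetLike.mem_coe]
    refine add_mem (add_mem ?_ ?_) ?_
    · exact Ideal.mul_mem_left _ _ (Ideal.subset_span (by simp))
    · exact Ideal.mul_mem_left _ _ (sub_mem (Ideal.subset_span (by simp))
        (Ideal.subset_span (by simp)))
    · exact Ideal.mul_mem_left _ _ (Ideal.subset_span (by simp))

theorem span_mul_formIdeal (h : IsQuadraticGenerator d θ) {a b c : ℤ}
    (hc : a * c = b ^ 2 - d) :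
    Ideal.span {((-b : ℤ) + θ : R)} * formIdeal θ a b =
      Ideal.span {(a : R)} * formIdeal θ c (-b) := by
  have hc' : (a * c : R) = b ^ 2 - d := by exact_mod_cast congrArg (Int.cast : ℤ → R) hc
  have e : ((-b : ℤ) + θ : R) * (b + θ) = -(a * c) := by
    push_cast
    linear_combination h.sq + hc'
  rw [formIdeal, formIdeal, Ideal.span_mul_span', Ideal.span_mul_span', Set.singleton_mul,
    Set.singleton_mul, Set.image_pair, Set.image_pair, e, Ideal.span_insert,
    Ideal.span_singleton_neg, ← Ideal.span_insert, Set.pair_comm, mul_comm ((-b : ℤ) + θ : R)]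

theorem intCast_ne_zero (h : IsQuadraticGenerator d θ) {a : ℤ} (ha : a ≠ 0) : (a : R) ≠ 0 :=
  fun h0 => ha (h.eq_zero a 0 (by simpa using h0)).1

theorem add_ne_zero (h : IsQuadraticGenerator d θ) (b : ℤ) : (b + θ : R) ≠ 0 :=
  fun h0 => one_ne_zero (h.eq_zero b 1 (by simpa using h0)).2

theorem ext (h : IsQuadraticGenerator d θ) {x y x' y' : ℤ}
    (e : (x : R) + y * θ = x' + y' * θ) : x = x' ∧ y = y' := by
  have := h.eq_zero (x - x') (y - y') (by push_cast; linear_combination e)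
  omega

theorem exists_formIdeal (h : IsQuadraticGenerator d θ) {I : Ideal R} (hI : I ≠ ⊥) :
    ∃ k a b c : ℤ, k ≠ 0 ∧ a * c = b ^ 2 - d ∧ I = Ideal.span {(k : R)} * formIdeal θ a b := by
  let P : Ideal ℤ :=
    { carrier := {y | ∃ x : ℤ, (x + y * θ : R) ∈ I}
      zero_mem' := ⟨0, by simp⟩
      add_mem' := by
        rintro y y' ⟨x, hx⟩ ⟨x', hx'⟩
        refine ⟨x + x', ?_⟩
        convert! I.add_mem hx hx' using 1
        push_cast; ring
      smul_mem' := by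
        rintro n y ⟨x, hx⟩
        refine ⟨n * x, ?_⟩
        convert! I.mul_mem_left (n : R) hx using 1
        push_cast [smul_eq_mul]; ring }
  have hP : ∀ y, y ∈ P ↔ ∃ x : ℤ, (x + y * θ : R) ∈ I := fun _ => Iff.rfl
  obtain ⟨k, hk⟩ := (IsPrincipalIdealRing.principal P).principal
  have hPk : ∀ y, y ∈ P ↔ k ∣ y := fun y => by
    rw [hk]; exact Ideal.mem_span_singleton
  obtain ⟨A, hA⟩ := (IsPrincipalIdealRing.principal (I.comap (Int.castRingHom R))).principal
  have hIA : ∀ x : ℤ, (x : R) ∈ I ↔ A ∣ x := fun x => by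
    rw [← Ideal.mem_span_singleton, Ideal.span, ← hA]; simp
  have hdvd : ∀ x y : ℤ, (x + y * θ : R) ∈ I → k ∣ x ∧ k ∣ y := fun x y hxy => by
    refine ⟨(hPk _).1 ⟨d * y, ?_⟩, (hPk _).1 ⟨x, hxy⟩⟩
    convert! I.mul_mem_left θ hxy using 1
    push_cast; linear_combination -(y : R) * h.sq
  have hk0 : k ≠ 0 := by
    rintro rfl
    refine hI (eq_bot_iff.2 fun z hz => ?_)
    obtain ⟨x, y, rfl⟩ := h.exists_eq z
    obtain ⟨h1, h2⟩ := hdvd x y hz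
    simp [zero_dvd_iff.1 h1, zero_dvd_iff.1 h2]
  obtain ⟨B, hB⟩ := (hP k).1 ((hPk k).2 dvd_rfl)
  obtain ⟨b, rfl⟩ := (hdvd _ _ hB).1
  obtain ⟨a, rfl⟩ : k ∣ A := by
    refine (hPk _).1 ⟨0, ?_⟩
    convert! I.mul_mem_left θ ((hIA A).2 dvd_rfl) using 1
    push_cast; ring
  obtain ⟨c, hc⟩ : k * a ∣ k * (b ^ 2 - d) := by
    rw [← hIA]
    convert! I.mul_mem_left (b - θ) hB using 1
    push_cast; linear_combination (k : R) * h.sq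
  have hc' : a * c = b ^ 2 - d := mul_left_cancel₀ hk0 (by rw [← mul_assoc, hc])
  refine ⟨k, a, b, c, hk0, hc', ?_⟩
  rw [formIdeal, Ideal.span_mul_span', Set.singleton_mul, Set.image_pair]
  apply le_antisymm
  · intro z hz
    obtain ⟨x, y, rfl⟩ := h.exists_eq z
    obtain ⟨t, rfl⟩ := (hdvd x y hz).2
    obtain ⟨s, hs⟩ : k * a ∣ x - t * (k * b) := by
      rw [← hIA]
      convert! I.sub_mem hz (I.mul_mem_left (t : R) hB) using 1
      push_cast; ring
    have hs' : (x - t * (k * b) : R) = k * a * s := by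
      exact_mod_cast congrArg (Int.cast : ℤ → R) hs
    refine Ideal.mem_span_pair.2 ⟨s, t, ?_⟩
    push_cast; linear_combination -hs'
  · rw [Ideal.span_le]
    rintro z (rfl | rfl) <;> rw [SetLike.mem_coe]
    · exact_mod_cast (hIA _).2 dvd_rfl
    · convert! hB using 1
      push_cast; ring

section Domain

variable [IsDomain R]

theorem sq_sub_ne_zero (h : IsQuadraticGenerator d θ) (b : ℤ) : b ^ 2 - d ≠ 0 := by
  intro h0
  have h0' : (b ^ 2 - d : R) = 0 := by exact_mod_cast congrArg (Int.cast : ℤ → R) h0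
  have := mul_ne_zero (h.add_ne_zero b) (h.add_ne_zero (-b))
  apply this
  push_cast
  linear_combination h.sq - h0'

/-- One reduction step `(a, b) ↦ (c, b')` between invertible ideals `(a, b + θ)`. -/
theorem representsClass_step (h : IsQuadraticGenerator d θ) {a b : ℤ} {C : ClassGroup R}
    (hC : RepresentsClass (formIdeal θ a b) C) (ha : a ≠ 0) (k c l b' : ℤ)
    (hc : a * c = (b + k * a) ^ 2 - d) (hb' : b' = -(b + k * a) + l * c) :
    RepresentsClass (formIdeal θ c b') C := by
  rw [hb', formIdeal_add_mul]
  rw [← formIdeal_add_mul θ a b k] at hC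
  exact hC.of_span_mul_eq (h.add_ne_zero _) (h.intCast_ne_zero ha) (h.span_mul_formIdeal hc)

theorem isUnit_of_dvd (h : IsQuadraticGenerator d θ) {a b c e : ℤ} {C : ClassGroup R}
    (hC : RepresentsClass (formIdeal θ a b) C) (hc : a * c = b ^ 2 - d)
    (hea : e ∣ a) (heb : e ∣ 2 * b) (hec : e ∣ c) : IsUnit e := by
  obtain ⟨a', rfl⟩ := hea
  obtain ⟨b', hb⟩ := heb
  obtain ⟨c', rfl⟩ := hec
  have hc' : ((e * a') * (e * c') : R) = b ^ 2 - d := by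
    exact_mod_cast congrArg (Int.cast : ℤ → R) hc
  have hb' : (2 * b : R) = e * b' := by exact_mod_cast congrArg (Int.cast : ℤ → R) hb
  have hdvd : (e : R) ∣ b + θ := by
    refine hC.dvd_of_span_mul_le (Ideal.span_singleton_mul_le_span_singleton_mul.2 ?_)
    intro z hz
    obtain ⟨s, t, rfl⟩ := Ideal.mem_span_pair.1 hz
    refine ⟨-(t * c') * (e * a' : ℤ) + (s * a' + t * b') * (b + θ),
      Ideal.mem_span_pair.2 ⟨_, _, rfl⟩, ?_⟩
    push_cast
    linear_combination (t : R) * h.sq + t * hc' + (t * (b + θ) : R) * hb'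
  obtain ⟨z, hz⟩ := hdvd
  obtain ⟨x, y, rfl⟩ := h.exists_eq z
  have := h.ext (x := b) (y := 1) (x' := e * x) (y' := e * y) (by push_cast; linear_combination hz)
  exact IsUnit.of_mul_eq_one _ this.2.symm

theorem exists_representsClass (h : IsQuadraticGenerator d θ) (C : ClassGroup R) :
    ∃ a b c : ℤ, a * c = b ^ 2 - d ∧ RepresentsClass (formIdeal θ a b) C := by
  obtain ⟨J, hJ, hC⟩ := RepresentsClass.exists_ideal C
  obtain ⟨k, a, b, c, hk, hc, rfl⟩ := h.exists_formIdeal hJ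
  exact ⟨a, b, c, hc, hC.of_span_mul_eq one_ne_zero (h.intCast_ne_zero hk) (by simp)⟩

/-- Every class is represented by a reduced form. -/
theorem exists_reduced (h : IsQuadraticGenerator d θ) (C : ClassGroup R) :
    ∃ a b c : ℤ, 0 < a ∧ 2 * |b| ≤ a ∧ a ≤ |c| ∧ a * c = b ^ 2 - d ∧
      RepresentsClass (formIdeal θ a b) C := by
  classical
  have hex : ∃ n : ℕ, ∃ a b c : ℤ, a.natAbs = n ∧ a * c = b ^ 2 - d ∧
      RepresentsClass (formIdeal θ a b) C := by
    obtain ⟨a, b, c, hc, hC⟩ := h.exists_representsClass C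
    exact ⟨_, a, b, c, rfl, hc, hC⟩
  obtain ⟨a, b, c, hn, hc, hC⟩ := Nat.find_spec hex
  have hmin : ∀ a' b' c' : ℤ, a' * c' = b' ^ 2 - d → RepresentsClass (formIdeal θ a' b') C →
      |a| ≤ |a'| := fun a' b' c' hc' hC' => by
    have := Nat.find_min' hex ⟨a', b', c', rfl, hc', hC'⟩
    rwa [Int.abs_eq_natAbs, Int.abs_eq_natAbs, hn, Nat.cast_le]
  obtain ⟨a, hapos, hc, hC, hmin⟩ : ∃ a₁ : ℤ, 0 < a₁ ∧ (∃ c, a₁ * c = b ^ 2 - d) ∧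
      RepresentsClass (formIdeal θ a₁ b) C ∧ ∀ a' b' c' : ℤ, a' * c' = b' ^ 2 - d →
      RepresentsClass (formIdeal θ a' b') C → a₁ ≤ |a'| := by
    have ha0 : a ≠ 0 := fun h0 => h.sq_sub_ne_zero b (by rw [← hc, h0, zero_mul])
    rcases abs_choice a with ha | ha <;> rw [ha] at hmin
    · exact ⟨a, ha ▸ abs_pos.2 ha0, ⟨c, hc⟩, hC, hmin⟩
    · exact ⟨-a, ha ▸ abs_pos.2 ha0, ⟨-c, by linarith⟩, by rwa [formIdeal_neg], hmin⟩
  obtain ⟨b₁, k, hb₁, hk⟩ : ∃ b₁ k : ℤ, 2 * |b₁| ≤ a ∧ b₁ = b + k * a := by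
    have h1 := Int.emod_add_mul_ediv (2 * b + a) (2 * a)
    have h2 := Int.emod_nonneg (2 * b + a) (by omega : 2 * a ≠ 0)
    have h3 := Int.emod_lt_of_pos (2 * b + a) (by omega : 0 < 2 * a)
    have h4 : |2 * (b + -((2 * b + a) / (2 * a)) * a)| ≤ a :=
      abs_le.2 ⟨by linarith, by linarith⟩
    rw [abs_mul, abs_two] at h4
    exact ⟨_, _, h4, rfl⟩
  rw [← formIdeal_add_mul θ a b k, ← hk] at hC
  obtain ⟨c₁, hc₁⟩ : ∃ c₁, a * c₁ = b₁ ^ 2 - d := by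
    obtain ⟨c, hc⟩ := hc
    exact ⟨c + 2 * b * k + k ^ 2 * a, by rw [hk]; linear_combination hc⟩
  refine ⟨a, b₁, c₁, hapos, hb₁, hmin c₁ (-b₁) a (by linarith) ?_, hc₁, hC⟩
  exact h.representsClass_step hC hapos.ne' 0 c₁ 0 _ (by simpa using hc₁) (by ring)

end Domain

end IsQuadraticGenerator

theorem isCyclic_and_card_eq_four {G : Type*} [Group G] {g : G} (h2 : g ^ 2 ≠ 1) (h4 : g ^ 4 = 1)
    (h : ∀ x : G, x = 1 ∨ x = g ∨ x = g⁻¹ ∨ x = g ^ 2) : IsCyclic G ∧ Nat.card G = 4 := by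
  have hg : ∀ x : G, x ∈ Subgroup.zpowers g := fun x => by
    rcases h x with rfl | rfl | rfl | rfl
    · exact one_mem _
    · exact Subgroup.mem_zpowers x
    · exact inv_mem (Subgroup.mem_zpowers g)
    · exact pow_mem (Subgroup.mem_zpowers g) 2
  refine ⟨⟨g, hg⟩, ?_⟩
  rw [← orderOf_eq_card_of_forall_mem_zpowers hg]
  exact orderOf_eq_prime_pow (p := 2) (n := 1) h2 h4

/-- The `y`-coordinate of every unit of norm one of `ℤ[√14]` is divisible by `4`. -/
theorem four_dvd_of_sq_sub_fourteen_mul_sq {x y : ℤ} (h : x ^ 2 - 14 * y ^ 2 = 1) : 4 ∣ y := by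
  let a₁ : Pell.Solution₁ 14 := Pell.Solution₁.mk 15 4 (by norm_num)
  have hfund : Pell.IsFundamental a₁ := by
    refine ⟨by simp [a₁], by simp [a₁], fun {a} ha => ?_⟩
    simp only [a₁, Pell.Solution₁.x_mk]
    by_contra! hlt
    have hp := a.prop
    have hy1 : a.y < 4 := by nlinarith
    have hy2 : -4 < a.y := by nlinarith
    generalize a.x = u at *
    generalize a.y = v at *
    interval_cases v <;> interval_cases u <;> omega
  let S : Subgroup (Pell.Solution₁ 14) :=
    { carrier := {a | 4 ∣ a.y}
      one_mem' := by simp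
      mul_mem' := by
        intro a b ha hb
        rw [Set.mem_ofPred_eq, Pell.Solution₁.y_mul]
        exact dvd_add (hb.mul_left _) (ha.mul_right _)
      inv_mem' := by
        intro a ha
        simpa using ha }
  have hS : ∀ a : Pell.Solution₁ 14, a ∈ S ↔ 4 ∣ a.y := fun _ => Iff.rfl
  have h₁ : a₁ ∈ S := by rw [hS]; simp [a₁]
  obtain ⟨n, hn | hn⟩ := hfund.eq_zpow_or_neg_zpow (Pell.Solution₁.mk x y h)
  · have := (hS _).1 (zpow_mem h₁ n)
    rwa [← hn, Pell.Solution₁.y_mk] at this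
  · have := (hS _).1 (zpow_mem h₁ n)
    rwa [← dvd_neg, ← Pell.Solution₁.y_neg, ← hn, Pell.Solution₁.y_mk] at this

theorem seven_mul_sq_sub_ne_one (x y : ℤ) : 7 * x ^ 2 - 128 * y ^ 2 ≠ 1 := by
  intro h
  have h7 : (5 * y ^ 2 : ZMod 7) = 1 := by
    have := congrArg (Int.cast : ℤ → ZMod 7) h
    push_cast at this
    reduce_mod_char at this
    exact this
  generalize (y : ZMod 7) = z at h7
  revert h7
  revert z
  decide

theorem seven_mul_sq_sub_ne_neg_one (x y : ℤ) : 7 * x ^ 2 - 128 * y ^ 2 ≠ -1 := by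
  intro h
  have h4 := four_dvd_of_sq_sub_fourteen_mul_sq (x := -7 * x + 32 * y) (y := 2 * x - 8 * y)
    (by linear_combination -h)
  have hx : x % 2 = 0 := by omega
  obtain ⟨u, rfl⟩ := Int.dvd_of_emod_eq_zero hx
  ring_nf at h
  omega

theorem reduced_form_896 {a b c : ℤ} (ha : 0 < a) (hb : 2 * |b| ≤ a) (hac : a ≤ |c|)
    (hc : a * c = b ^ 2 - 896) (hodd : ¬ (2 ∣ a ∧ 2 ∣ c)) :
    (a, b) ∈ [(1, 0), (4, -2), (4, 2), (5, -1), (5, 1), (7, 0), (11, -4), (11, 4), (13, -5),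
      (13, 5), (16, -4), (16, 4), (20, -6), (20, 6), (25, -11), (25, 11)] := by
  have hb₁ : 2 * b ≤ a := by linarith [le_abs_self b]
  have hb₂ : -a ≤ 2 * b := by linarith [neg_abs_le b]
  have ha' : a < 30 := by
    rcases abs_cases c with ⟨h, _⟩ | ⟨h, _⟩ <;> nlinarith
  have hac' : a ≤ c ∨ a ≤ -c := le_abs.1 hac
  clear hb hac
  have hb₃ : -15 < b := by omega
  have hb₄ : b < 15 := by omega
  interval_cases a <;> interval_cases b <;> first | (exfalso; omega) | simp

theorem reduced_form_neg_14 {a b c : ℤ} (ha : 0 < a) (hb : 2 * |b| ≤ a) (hac : a ≤ |c|)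
    (hc : a * c = b ^ 2 - (-14)) :
    (a, b) ∈ [(1, 0), (2, 0), (3, -1), (3, 1)] := by
  have hb₁ : 2 * b ≤ a := by linarith [le_abs_self b]
  have hb₂ : -a ≤ 2 * b := by linarith [neg_abs_le b]
  have ha' : a < 5 := by
    rcases abs_cases c with ⟨h, _⟩ | ⟨h, _⟩ <;> nlinarith
  clear hb hac
  have hb₃ : -3 < b := by omega
  have hb₄ : b < 3 := by omega
  interval_cases a <;> interval_cases b <;> first | (exfalso; omega) | simp

namespace IsQuadraticGenerator

variable {R : Type*} [CommRing R] [IsDomain R] {θ : R}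

theorem representsClass_one : RepresentsClass (formIdeal (R := R) θ 1 0) 1 :=
  RepresentsClass.one_iff.2 ⟨1, one_ne_zero, by
    rw [Ideal.span_singleton_one, Ideal.eq_top_iff_one]
    exact Ideal.subset_span (by simp)⟩

/-- A generator of `(a, θ)` has norm dividing both `a ^ 2` and `d`, and its first coordinate is
divisible by `a` when `d` is. -/
theorem exists_norm_dvd {d : ℤ} (h : IsQuadraticGenerator d θ) {a : ℤ} (had : a ∣ d)
    (hC : RepresentsClass (formIdeal θ a 0) 1) :
    ∃ x y : ℤ, x ^ 2 - d * y ^ 2 ∣ a ^ 2 ∧ x ^ 2 - d * y ^ 2 ∣ d ∧ a ∣ x := by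
  obtain ⟨g, -, hg⟩ := RepresentsClass.one_iff.1 hC
  have key : ∀ x y s t m n : ℤ, (m + n * θ : R) = (s + t * θ) * (x + y * θ) →
      m ^ 2 - d * n ^ 2 = (x ^ 2 - d * y ^ 2) * (s ^ 2 - d * t ^ 2) := by
    intro x y s t m n e
    obtain ⟨rfl, rfl⟩ := h.ext (x := m) (y := n) (x' := s * x + d * (t * y)) (y' := s * y + t * x) (by
      push_cast; linear_combination e + (t * y : R) * h.sq)
    ring
  obtain ⟨x, y, rfl⟩ := h.exists_eq g
  refine ⟨x, y, ?_, ?_, ?_⟩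
  · obtain ⟨z, hz⟩ := Ideal.mem_span_singleton'.1 (hg ▸ Ideal.subset_span (by simp) :
      (a : R) ∈ Ideal.span {(x + y * θ : R)})
    obtain ⟨s, t, rfl⟩ := h.exists_eq z
    exact ⟨_, by simpa using key x y s t a 0 (by simpa using hz.symm)⟩
  · obtain ⟨z, hz⟩ := Ideal.mem_span_singleton'.1 (hg ▸ Ideal.subset_span (by simp) :
      θ ∈ Ideal.span {(x + y * θ : R)})
    obtain ⟨s, t, rfl⟩ := h.exists_eq z
    rw [← dvd_neg]
    exact ⟨_, by simpa using key x y s t 0 1 (by simpa using hz.symm)⟩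
  · obtain ⟨u, v, huv⟩ := Ideal.mem_span_pair.1 (hg ▸ Ideal.mem_span_singleton_self _ :
      (x + y * θ : R) ∈ formIdeal θ a 0)
    obtain ⟨p, q, rfl⟩ := h.exists_eq u
    obtain ⟨s, t, rfl⟩ := h.exists_eq v
    obtain ⟨d', rfl⟩ := had
    have := h.ext (x := x) (y := y) (x' := p * a + t * (a * d')) (y' := q * a + s) (by
      have hs := h.sq
      push_cast at huv hs ⊢
      linear_combination -huv + (t : R) * hs)
    exact ⟨p + t * d', by linear_combination this.1⟩

theorem not_representsClass_seven_one (h : IsQuadraticGenerator 896 θ) :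
    ¬ RepresentsClass (formIdeal θ 7 0) 1 := by
  intro hC
  obtain ⟨x, y, h1, h2, w, rfl⟩ := h.exists_norm_dvd (by norm_num) hC
  have h3 : 7 * (7 * w ^ 2 - 128 * y ^ 2) ∣ 7 * 1 := by
    convert! dvd_gcd h1 h2 using 1
    ring
  rcases Int.isUnit_iff.1 (isUnit_of_dvd_one (Int.dvd_of_mul_dvd_mul_left (by norm_num) h3)) with
    h4 | h4
  · exact seven_mul_sq_sub_ne_one _ _ h4
  · exact seven_mul_sq_sub_ne_neg_one _ _ h4

theorem not_representsClass_two_one (h : IsQuadraticGenerator (-14) θ) :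
    ¬ RepresentsClass (formIdeal θ 2 0) 1 := by
  intro hC
  obtain ⟨x, y, h1, h2, w, rfl⟩ := h.exists_norm_dvd (by norm_num) hC
  have h3 : 2 * (2 * w ^ 2 + 7 * y ^ 2) ∣ 2 * 1 := by
    convert! dvd_gcd h1 h2 using 1
    ring
  have h4 := Int.le_of_dvd one_pos (Int.dvd_of_mul_dvd_mul_left (by norm_num) h3)
  have hy : y ^ 2 = 0 := by nlinarith [sq_nonneg y, sq_nonneg w]
  have hw : w ^ 2 = 0 := by nlinarith [sq_nonneg y, sq_nonneg w]
  rw [hy, hw] at h3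
  norm_num at h3

theorem classGroup_896 (h : IsQuadraticGenerator 896 θ) :
    IsCyclic (ClassGroup R) ∧ Nat.card (ClassGroup R) = 4 := by
  obtain ⟨g, hg, hg'⟩ := RepresentsClass.exists_of_mul_eq_span (h.intCast_ne_zero (by norm_num))
    (h.formIdeal_mul_conj (a := 5) (b := 1) (-179) 1 (-2) 0 (by norm_num) (by norm_num))
  have h11 : ∀ {C : ClassGroup R}, RepresentsClass (formIdeal θ 11 4) C → C = g⁻¹ := fun hC => by
    have := h.representsClass_step hC (by norm_num) (-3) (-5) 6 (-1) (by norm_num) (by norm_num)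
    rw [formIdeal_neg] at this
    exact this.eq_class hg'
  have h11' : ∀ {C : ClassGroup R}, RepresentsClass (formIdeal θ 11 (-4)) C → C = g := fun hC => by
    have := h.representsClass_step hC (by norm_num) 3 (-5) (-6) 1 (by norm_num) (by norm_num)
    rw [formIdeal_neg] at this
    exact this.eq_class hg
  have h16 : ∀ {C : ClassGroup R}, RepresentsClass (formIdeal θ 16 4) C →
      RepresentsClass (formIdeal θ 7 0) C := fun hC => by
    have := h.representsClass_step hC (by norm_num) (-2) (-7) 4 0 (by norm_num) (by norm_num)
    rwa [formIdeal_neg] at this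
  have h16' : ∀ {C : ClassGroup R}, RepresentsClass (formIdeal θ 16 (-4)) C →
      RepresentsClass (formIdeal θ 7 0) C := fun hC => by
    have := h.representsClass_step hC (by norm_num) 2 (-7) (-4) 0 (by norm_num) (by norm_num)
    rwa [formIdeal_neg] at this
  have h25 : ∀ {C : ClassGroup R}, RepresentsClass (formIdeal θ 25 11) C →
      RepresentsClass (formIdeal θ 7 0) C := fun hC =>
    h16' (h.representsClass_step hC (by norm_num) 1 16 2 (-4) (by norm_num) (by norm_num))
  have hg2 : RepresentsClass (formIdeal θ 7 0) (g ^ 2) := by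
    have h0 : RepresentsClass (formIdeal θ 5 11) g := by
      simpa using (formIdeal_add_mul θ 5 1 2).symm ▸ hg
    have h1 := h0.mul h0
    rw [h.formIdeal_mul (a₁ := 5) (a₂ := 5) (b := 11) (-31) (-13) 0 3 (by norm_num)
      (by norm_num), ← pow_two g] at h1
    exact h25 h1
  obtain ⟨C, hC, hC'⟩ := RepresentsClass.exists_of_mul_eq_span (h.intCast_ne_zero (by norm_num))
    (h.formIdeal_mul_conj (a := 7) (b := 0) (-128) 55 0 3 (by norm_num) (by norm_num))
  rw [neg_zero] at hC'
  refine isCyclic_and_card_eq_four (g := g)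
    (fun h1 => h.not_representsClass_seven_one (h1 ▸ hg2)) ?_ fun C => ?_
  · have h1 := hg2.eq_class hC'
    rw [← hg2.eq_class hC, eq_inv_iff_mul_eq_one] at h1
    rwa [← pow_add] at h1
  obtain ⟨a, b, c, ha, hb, hac, hc, hC⟩ := h.exists_reduced C
  have hmem := reduced_form_896 ha hb hac hc fun ⟨h1, h2⟩ =>
    absurd (h.isUnit_of_dvd hC hc h1 (dvd_mul_right 2 b) h2) (by decide)
  simp only [List.mem_cons, Prod.mk.injEq, List.not_mem_nil, or_false] at hmem
  clear ha hb hac hc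
  rcases hmem with ⟨rfl, rfl⟩ | ⟨rfl, rfl⟩ | ⟨rfl, rfl⟩ | ⟨rfl, rfl⟩ | ⟨rfl, rfl⟩ | ⟨rfl, rfl⟩ |
    ⟨rfl, rfl⟩ | ⟨rfl, rfl⟩ | ⟨rfl, rfl⟩ | ⟨rfl, rfl⟩ | ⟨rfl, rfl⟩ | ⟨rfl, rfl⟩ | ⟨rfl, rfl⟩ |
    ⟨rfl, rfl⟩ | ⟨rfl, rfl⟩ | ⟨rfl, rfl⟩
  · exact .inl (hC.eq_class representsClass_one)
  · exact .inl ((h.representsClass_step hC (by norm_num) (-7) 1 (-30) 0 (by norm_num)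
      (by norm_num)).eq_class representsClass_one)
  · exact .inl ((h.representsClass_step hC (by norm_num) 7 1 30 0 (by norm_num)
      (by norm_num)).eq_class representsClass_one)
  · exact .inr (.inr (.inl (hC.eq_class hg')))
  · exact .inr (.inl (hC.eq_class hg))
  · exact .inr (.inr (.inr (hC.eq_class hg2)))
  · exact .inr (.inl (h11' hC))
  · exact .inr (.inr (.inl (h11 hC)))
  · exact .inr (.inl ((h.representsClass_step hC (by norm_num) (-2) 5 (-6) 1 (by norm_num)
      (by norm_num)).eq_class hg))
  · exact .inr (.inr (.inl ((h.representsClass_step hC (by norm_num) 2 5 6 (-1) (by norm_num)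
      (by norm_num)).eq_class hg')))
  · exact .inr (.inr (.inr ((h16' hC).eq_class hg2)))
  · exact .inr (.inr (.inr ((h16 hC).eq_class hg2)))
  · refine .inr (.inr (.inl (h11 ?_)))
    rw [← formIdeal_neg]
    exact h.representsClass_step hC (by norm_num) (-1) (-11) 2 4 (by norm_num) (by norm_num)
  · refine .inr (.inl (h11' ?_))
    rw [← formIdeal_neg]
    exact h.representsClass_step hC (by norm_num) 1 (-11) (-2) (-4) (by norm_num) (by norm_num)
  · exact .inr (.inr (.inr ((h16 (h.representsClass_step hC (by norm_num) (-1) 16 (-2) 4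
      (by norm_num) (by norm_num))).eq_class hg2)))
  · exact .inr (.inr (.inr ((h25 hC).eq_class hg2)))

theorem classGroup_neg_14 (h : IsQuadraticGenerator (-14) θ) :
    IsCyclic (ClassGroup R) ∧ Nat.card (ClassGroup R) = 4 := by
  obtain ⟨g, hg, hg'⟩ := RepresentsClass.exists_of_mul_eq_span (h.intCast_ne_zero (by norm_num))
    (h.formIdeal_mul_conj (a := 3) (b := 1) 5 1 (-1) 0 (by norm_num) (by norm_num))
  have hg2 : RepresentsClass (formIdeal θ 2 0) (g ^ 2) := by
    have h0 : RepresentsClass (formIdeal θ 3 (-2)) g := by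
      simpa using (formIdeal_add_mul θ 3 1 (-1)).symm ▸ hg
    have h1 := h0.mul h0
    rw [h.formIdeal_mul (a₁ := 3) (a₂ := 3) (b := -2) 2 (-1) 0 (-1) (by norm_num)
      (by norm_num), ← pow_two g] at h1
    exact h.representsClass_step h1 (by norm_num) 0 2 (-1) 0 (by norm_num) (by norm_num)
  obtain ⟨C, hC, hC'⟩ := RepresentsClass.exists_of_mul_eq_span (h.intCast_ne_zero (by norm_num))
    (h.formIdeal_mul_conj (a := 2) (b := 0) 7 (-3) 0 1 (by norm_num) (by norm_num))
  rw [neg_zero] at hC'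
  refine isCyclic_and_card_eq_four (g := g)
    (fun h1 => h.not_representsClass_two_one (h1 ▸ hg2)) ?_ fun C => ?_
  · have h1 := hg2.eq_class hC'
    rw [← hg2.eq_class hC, eq_inv_iff_mul_eq_one] at h1
    rwa [← pow_add] at h1
  obtain ⟨a, b, c, ha, hb, hac, hc, hC⟩ := h.exists_reduced C
  have hmem := reduced_form_neg_14 ha hb hac hc
  simp only [List.mem_cons, Prod.mk.injEq, List.not_mem_nil, or_false] at hmem
  clear ha hb hac hc
  rcases hmem with ⟨rfl, rfl⟩ | ⟨rfl, rfl⟩ | ⟨rfl, rfl⟩ | ⟨rfl, rfl⟩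
  · exact .inl (hC.eq_class representsClass_one)
  · exact .inr (.inr (.inr (hC.eq_class hg2)))
  · exact .inr (.inr (.inl (hC.eq_class hg')))
  · exact .inr (.inl (hC.eq_class hg))

end IsQuadraticGenerator

theorem exists_eq_add_mul_of_mem_adjoin {L : Type*} [Field L] [Algebra ℚ L] {s : L} {d : ℤ}
    (hs : s ^ 2 = d) {z : L} (hz : z ∈ ℚ⟮s⟯) : ∃ p q : ℚ, z = p + q * s := by
  have : CharZero L := algebraRat.charZero L
  induction hz using adjoin_induction with
  | mem x hx => exact ⟨0, 1, by simpa using hx⟩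
  | algebraMap x => exact ⟨x, 0, by simp⟩
  | add x y _ _ hx hy =>
    obtain ⟨p, q, rfl⟩ := hx
    obtain ⟨p', q', rfl⟩ := hy
    exact ⟨p + p', q + q', by push_cast; ring⟩
  | inv x _ hx =>
    obtain ⟨p, q, rfl⟩ := hx
    by_cases h0 : (p + q * s : L) = 0
    · exact ⟨0, 0, by simp [h0]⟩
    by_cases h1 : p ^ 2 - d * q ^ 2 = 0
    · have h1' : (p ^ 2 - d * q ^ 2 : L) = 0 := by exact_mod_cast congrArg (Rat.cast : ℚ → L) h1
      have h2 : (p + q * s : L) * (p - q * s) = 0 := by linear_combination h1' - q ^ 2 * hs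
      have h3 : (p - q * s : L) = 0 := (mul_eq_zero.1 h2).resolve_left h0
      have h4 : (p + q * s : L) = (2 * p : ℚ) := by push_cast; linear_combination -h3
      exact ⟨(2 * p)⁻¹, 0, by rw [h4]; push_cast; ring⟩
    · refine ⟨p / (p ^ 2 - d * q ^ 2), -q / (p ^ 2 - d * q ^ 2), inv_eq_of_mul_eq_one_right ?_⟩
      have h1' : (p ^ 2 - d * q ^ 2 : L) ≠ 0 := by exact_mod_cast h1
      push_cast
      rw [mul_add, mul_div_assoc', ← mul_assoc, mul_div_assoc', div_mul_eq_mul_div, ← add_div,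
        div_eq_one_iff_eq h1']
      linear_combination -(q ^ 2 : L) * hs
  | mul x y _ _ hx hy =>
    obtain ⟨p, q, rfl⟩ := hx
    obtain ⟨p', q', rfl⟩ := hy
    exact ⟨p * p' + d * (q * q'), p * q' + p' * q, by
      push_cast; linear_combination (q * q' : L) * hs⟩

theorem not_isSquare_of_emod_four_eq_two {d : ℤ} (hd : d % 4 = 2) : ¬ IsSquare (d : ℚ) := by
  rw [Rat.isSquare_intCast_iff]
  rintro ⟨r, rfl⟩
  rcases Int.even_or_odd' r with ⟨k, rfl | rfl⟩ <;> ring_nf at hd <;> omega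

theorem eq_zero_of_add_mul_eq_zero {K : Type*} [Field K] [CharZero K] {s : K} {d : ℤ}
    (hs : s ^ 2 = d) (hd : ¬ IsSquare (d : ℚ)) {p q : ℚ} (h : (p + q * s : K) = 0) :
    p = 0 ∧ q = 0 := by
  have hq : q = 0 := by
    by_contra hq
    refine hd ⟨p / q, ?_⟩
    have e : (p ^ 2 : K) = d * q ^ 2 := by linear_combination (p - q * s : K) * h + (q ^ 2 : K) * hs
    have e' : p ^ 2 = d * q ^ 2 := by exact_mod_cast e
    field_simp
    exact e'.symm
  subst hq
  simpa using h

/-- The trace and the norm of an integral element `p + q √d` are integers. -/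
theorem exists_int_trace_norm {K : Type*} [Field K] [CharZero K] {s : K} {d : ℤ}
    (hs : s ^ 2 = d) (hd : ¬ IsSquare (d : ℚ)) {p q : ℚ} (h : IsIntegral ℤ (p + q * s : K)) :
    ∃ t n : ℤ, (t : ℚ) = 2 * p ∧ (n : ℚ) = p ^ 2 - d * q ^ 2 := by
  by_cases hq : q = 0
  · subst hq
    have hp : IsIntegral ℤ p := by
      rw [← isIntegral_algebraMap_iff (B := K) (algebraMap ℚ K).injective]
      simpa using h
    obtain ⟨m, rfl⟩ := IsIntegrallyClosed.isIntegral_iff.1 hp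
    exact ⟨2 * m, m ^ 2, by simp, by simp⟩
  · set z : K := p + q * s with hz
    have hQ : IsIntegral ℚ z := h.tower_top
    let F : ℚ[X] := X ^ 2 - C (2 * p) * X + C (p ^ 2 - d * q ^ 2)
    have hFm : F.Monic := by unfold F; monicity!
    have hFd : F.natDegree = 2 := by unfold F; compute_degree!
    have hF : aeval z F = 0 := by
      simp only [F, map_add, map_sub, map_mul, map_pow, aeval_X, aeval_C, eq_ratCast, hz]
      push_cast
      linear_combination (q ^ 2 : K) * hs
    have h2 : 2 ≤ (minpoly ℚ z).natDegree := by
      rw [minpoly.two_le_natDegree_iff hQ]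
      rintro ⟨r, hr⟩
      refine hq (eq_zero_of_add_mul_eq_zero (p := p - r) hs hd ?_).2
      rw [eq_ratCast, hz] at hr
      push_cast
      linear_combination -hr
    have hmin : F = minpoly ℚ z := eq_of_monic_of_dvd_of_natDegree_le (minpoly.monic hQ) hFm
      (minpoly.dvd ℚ z hF) (hFd ▸ h2)
    rw [minpoly.isIntegrallyClosed_eq_field_fractions' ℚ h] at hmin
    refine ⟨-(minpoly ℤ z).coeff 1, (minpoly ℤ z).coeff 0, ?_, ?_⟩
    · have := congrArg (fun f => coeff f 1) hmin
      simp [F, coeff_C, -map_mul, -map_pow, -map_sub] at this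
      push_cast
      linarith
    · have := congrArg (fun f => coeff f 0) hmin
      simp [F, -map_mul, -map_pow, -map_sub] at this
      linarith

theorem exists_int_of_isIntegral {K : Type*} [Field K] [CharZero K] {s : K} {d : ℤ}
    (hs : s ^ 2 = d) (hsq : Squarefree d) (hd : d % 4 = 2) {p q : ℚ}
    (h : IsIntegral ℤ (p + q * s : K)) : ∃ x y : ℤ, p = x ∧ q = y := by
  obtain ⟨t, n, ht, hn⟩ := exists_int_trace_norm hs (not_isSquare_of_emod_four_eq_two hd) h
  obtain ⟨u, hu⟩ : ∃ u : ℤ, (u : ℚ) = 2 * q := by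
    have hd0 : (d : ℚ) ≠ 0 := by exact_mod_cast hsq.ne_zero
    have e : ((d * (t ^ 2 - 4 * n) : ℤ) : ℚ) = (d * (2 * q)) ^ 2 := by
      push_cast
      rw [ht, hn]
      ring
    obtain ⟨r, hr⟩ := Rat.isSquare_intCast_iff.1 ⟨_, e.trans (pow_two _)⟩
    obtain ⟨u, rfl⟩ : d ∣ r := hsq.isRadical 2 r ⟨_, (pow_two r).trans hr.symm⟩
    rw [hr, Int.cast_mul, ← pow_two, sq_eq_sq_iff_eq_or_eq_neg] at e
    push_cast at e
    rcases e with e | e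
    · exact ⟨u, mul_left_cancel₀ hd0 e⟩
    · exact ⟨-u, mul_left_cancel₀ hd0 (by push_cast; linear_combination -e)⟩
  have e : t ^ 2 - d * u ^ 2 = 4 * n := by
    have : (t ^ 2 - d * u ^ 2 : ℚ) = 4 * n := by rw [ht, hu, hn]; ring
    exact_mod_cast this
  obtain ⟨k, rfl⟩ : ∃ k, d = 4 * k + 2 := ⟨d / 4, by omega⟩
  obtain ⟨x, rfl | rfl⟩ := Int.even_or_odd' t <;> obtain ⟨y, rfl | rfl⟩ := Int.even_or_odd' u
  · push_cast at ht hu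
    exact ⟨x, y, by linarith, by linarith⟩
  all_goals ring_nf at e; omega

theorem isQuadraticGenerator_ringOfIntegers {L : Type*} [Field L] [Algebra ℚ L] {s : L} {d : ℤ}
    [NumberField ℚ⟮s⟯] (hs : s ^ 2 = d) (hsq : Squarefree d) (hd : d % 4 = 2) :
    ∃ θ : 𝓞 ℚ⟮s⟯, IsQuadraticGenerator d θ := by
  have hs' : (AdjoinSimple.gen ℚ s) ^ 2 = (d : ℚ⟮s⟯) := Subtype.ext (by simpa using hs)
  have h_integral : IsIntegral ℤ (AdjoinSimple.gen ℚ s) :=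
    IsIntegral.of_pow two_pos (hs' ▸ isIntegral_algebraMap (x := d))
  obtain ⟨θ, hθ⟩ : ∃ θ : 𝓞 ℚ⟮s⟯, algebraMap _ ℚ⟮s⟯ θ = AdjoinSimple.gen ℚ s := ⟨⟨_, h_integral⟩, rfl⟩
  refine ⟨θ, ?_, fun z => ?_, fun x y hxy => ?_⟩
  · exact FaithfulSMul.algebraMap_injective _ ℚ⟮s⟯ (by rw [map_pow, map_intCast, hθ]; exact hs')
  · obtain ⟨p, q, hpq⟩ := exists_eq_add_mul_of_mem_adjoin hs (z : ℚ⟮s⟯).2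
    have hz : algebraMap _ ℚ⟮s⟯ z = p + q * AdjoinSimple.gen ℚ s := Subtype.ext (by simpa using hpq)
    obtain ⟨x, y, rfl, rfl⟩ := exists_int_of_isIntegral hs' hsq hd 
      (p := p) (q := q) (by rw [← hz]; exact z.isIntegral_coe)
    refine ⟨x, y, FaithfulSMul.algebraMap_injective _ ℚ⟮s⟯ ?_⟩
    rw [map_add, map_mul, map_intCast, map_intCast, hθ]
    simpa using hz
  · have := congrArg (algebraMap (𝓞 ℚ⟮s⟯) ℚ⟮s⟯) hxy
    rw [map_add, map_mul, map_intCast, map_intCast, map_zero, hθ] at this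
    have := eq_zero_of_add_mul_eq_zero (p := x) (q := y) hs'
      (not_isSquare_of_emod_four_eq_two hd) (by push_cast; exact this)
    exact_mod_cast this

/-- `f θ` generates the order of conductor `f`. -/
theorem isQuadraticGenerator_conductorOrder {K : Type*} [Field K] [NumberField K] {d : ℤ}
    {θ : 𝓞 K} (h : IsQuadraticGenerator d θ) {f : ℕ} (hf : f ≠ 0) :
    ∃ ω : conductorOrder K f, IsQuadraticGenerator (f ^ 2 * d) ω := by
  refine ⟨⟨f * θ, 0, θ, by simp⟩, ?_, fun ⟨z, a, y, hz⟩ => ?_, fun x y hxy => ?_⟩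
  · refine Subtype.ext ?_
    push_cast
    linear_combination (f ^ 2 : 𝓞 K) * h.sq
  · obtain ⟨m, n, rfl⟩ := h.exists_eq y
    refine ⟨a + f * m, n, Subtype.ext ?_⟩
    push_cast
    linear_combination hz
  · have := congrArg Subtype.val hxy
    push_cast at this
    have := h.eq_zero x (y * f) (by push_cast; linear_combination this)
    simpa [hf] using this

theorem squarefree_fourteen : Squarefree 14 :=
  (Nat.squarefree_mul (m := 2) (n := 7) (by norm_num)).2
    ⟨Nat.prime_two.squarefree, (by norm_num : Nat.Prime 7).squarefree⟩

/-- The class group of the order `R = ℤ + 8·O` of conductor `8` in `ℚ(√14)` is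
isomorphic to `ℤ/4ℤ`, hence isomorphic to the ideal class group of the ring of
integers of `ℚ(√-14)`. -/
theorem classGroup_conductor8_order_sqrt14 :
    Nonempty (ClassGroup (conductorOrder ℚ⟮Real.sqrt (14 : ℕ)⟯ 8) ≃*
      Multiplicative (ZMod 4)) ∧
    Nonempty (ClassGroup (conductorOrder ℚ⟮Real.sqrt (14 : ℕ)⟯ 8) ≃*
      ClassGroup (𝓞 ℚ⟮(Real.sqrt (14 : ℕ) : ℂ) * Complex.I⟯)) := by
  obtain ⟨θ, hθ⟩ := isQuadraticGenerator_ringOfIntegers (s := Real.sqrt (14 : ℕ)) (d := 14)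
    (by norm_num) (by rw [← Int.squarefree_natAbs]; exact squarefree_fourteen) (by norm_num)
  obtain ⟨ω, hω⟩ := isQuadraticGenerator_conductorOrder hθ (f := 8) (by norm_num)
  obtain ⟨θ', hθ'⟩ := isQuadraticGenerator_ringOfIntegers
    (s := (Real.sqrt (14 : ℕ) : ℂ) * Complex.I) (d := -14)
    (by rw [mul_pow, Complex.I_sq, ← Complex.ofReal_pow, Real.sq_sqrt (by positivity)]; norm_num)
    (by rw [← Int.squarefree_natAbs]; exact squarefree_fourteen) (by norm_num)
  norm_num at hω
  obtain ⟨hc, hcard⟩ := hω.classGroup_896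
  obtain ⟨hc', hcard'⟩ := hθ'.classGroup_neg_14
  exact ⟨⟨mulEquivOfCyclicCardEq (by rw [hcard]; simp)⟩,
    ⟨mulEquivOfCyclicCardEq (by rw [hcard, hcard'])⟩⟩
end

section
/- For each D in the set {2, 3, 7, 11, 19, 43, 67}, the class number of the real quadratic field ℚ(√D) is 1, i.e., the ideal class group of its ring of integers is trivial. -/
open NumberField IntermediateField Polynomial

namespace QuadraticBasis

variable {K : Type*} [Field K] [NumberField K] {b : Module.Basis (Fin 2) ℚ K} {s : 𝓞 K} {D : ℕ}

theorem leftMulMatrix_add_mul (h0 : b 0 = 1) (h1 : b 1 = s) (hs : s ^ 2 = D) (a c : ℚ) :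
    Algebra.leftMulMatrix b (algebraMap ℚ K a + algebraMap ℚ K c * s) = !![a, D * c; c, a] := by
  have hs' : (s : K) * s = algebraMap ℚ K D := by
    rw [← sq, ← map_pow, hs]; simp
  have e0 : (algebraMap ℚ K a + algebraMap ℚ K c * s) * b 0 = a • b 0 + c • b 1 := by
    rw [h0, h1, Algebra.smul_def, Algebra.smul_def]; ring
  have e1 : (algebraMap ℚ K a + algebraMap ℚ K c * s) * b 1 = (D * c) • b 0 + a • b 1 := by
    rw [h0, h1, Algebra.smul_def, Algebra.smul_def, map_mul, ← hs']; ring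
  ext i j
  rw [Algebra.leftMulMatrix_eq_repr_mul]
  fin_cases j
  · simp only [Fin.zero_eta, e0]
    fin_cases i <;> simp
  · simp only [Fin.mk_one, e1]
    fin_cases i <;> simp

theorem norm_add_mul (h0 : b 0 = 1) (h1 : b 1 = s) (hs : s ^ 2 = D) (a c : ℤ) :
    Algebra.norm ℤ ((a : 𝓞 K) + c * s) = a ^ 2 - D * c ^ 2 := by
  have h := leftMulMatrix_add_mul h0 h1 hs a c
  have key : Algebra.norm ℚ (((a : 𝓞 K) + c * s : 𝓞 K) : K) = (a : ℚ) ^ 2 - D * c ^ 2 := by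
    rw [Algebra.norm_eq_matrix_det b]
    simp only [map_add, map_mul, map_intCast] at h ⊢
    rw [h, Matrix.det_fin_two_of]
    ring
  rw [← Algebra.coe_norm_int] at key
  exact_mod_cast key

theorem trace_add_mul (h0 : b 0 = 1) (h1 : b 1 = s) (hs : s ^ 2 = D) (a c : ℤ) :
    Algebra.trace ℤ (𝓞 K) ((a : 𝓞 K) + c * s) = 2 * a := by
  have h := leftMulMatrix_add_mul h0 h1 hs a c
  have key : Algebra.trace ℚ K (((a : 𝓞 K) + c * s : 𝓞 K) : K) = 2 * a := by
    rw [Algebra.trace_eq_matrix_trace b]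
    simp only [map_add, map_mul, map_intCast] at h ⊢
    rw [h, Matrix.trace_fin_two_of]
    ring
  rw [← Algebra.coe_trace_int] at key
  exact_mod_cast key

theorem discr_one_sqrt (h0 : b 0 = 1) (h1 : b 1 = s) (hs : s ^ 2 = D) :
    Algebra.discr ℤ ![1, s] = 4 * D := by
  have t := trace_add_mul h0 h1 hs
  have t1 : Algebra.trace ℤ (𝓞 K) 1 = 2 := by simpa using t 1 0
  have ts : Algebra.trace ℤ (𝓞 K) s = 0 := by simpa using t 0 1
  have tD : Algebra.trace ℤ (𝓞 K) (s * s) = 2 * D := by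
    rw [← sq, hs]; simpa using t D 0
  rw [Algebra.discr_def, Matrix.det_fin_two]
  simp only [Algebra.traceMatrix_apply, Algebra.traceForm_apply, Matrix.cons_val_zero,
    Matrix.cons_val_one, mul_one, one_mul, t1, ts, tD]
  ring

theorem finrank_eq_two (b : Module.Basis (Fin 2) ℚ K) : Module.finrank ℚ K = 2 := by
  simp [Module.finrank_eq_card_basis b]

theorem abs_discr_le (h0 : b 0 = 1) (h1 : b 1 = s) (hs : s ^ 2 = D) (hD : 0 < D) :
    |discr K| ≤ 4 * D := by
  let B : Module.Basis (Fin 2) ℤ (𝓞 K) :=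
    Module.finBasisOfFinrankEq ℤ (𝓞 K) ((RingOfIntegers.rank K).trans (finrank_eq_two b))
  have h := Algebra.discr_of_matrix_vecMul (A := ℤ) B (B.toMatrix ![1, s])
  rw [B.toMatrix_map_vecMul, discr_one_sqrt h0 h1 hs, discr_eq_discr] at h
  have h' : (4 * D : ℤ) = (B.toMatrix ![1, s]).det ^ 2 * |discr K| := by
    rw [← abs_sq, ← abs_mul, ← h, abs_of_nonneg (by positivity)]
  have hdet : (B.toMatrix ![1, s]).det ≠ 0 := by
    intro h0
    rw [h0] at h'
    simp at h'
    omega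
  have : 1 ≤ (B.toMatrix ![1, s]).det ^ 2 := by
    have := sq_pos_of_ne_zero hdet
    omega
  nlinarith [abs_nonneg (discr K)]

theorem nrComplexPlaces_eq_zero (b : Module.Basis (Fin 2) ℚ K) (φ : K →+* ℝ) :
    InfinitePlace.nrComplexPlaces K = 0 := by
  have h := InfinitePlace.card_add_two_mul_card_eq_rank K
  rw [finrank_eq_two b] at h
  have hφ : (InfinitePlace.mk (Complex.ofRealHom.comp φ)).IsReal := by
    rw [InfinitePlace.isReal_mk_iff, ComplexEmbedding.isReal_iff]
    ext x
    simp
  have : 0 < InfinitePlace.nrRealPlaces K := by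
    classical exact Fintype.card_pos_iff.mpr ⟨⟨_, hφ⟩⟩
  omega

theorem isPrincipal_of_norm_eq (h0 : b 0 = 1) (h1 : b 1 = s) (hs : s ^ 2 = D) {p : ℕ}
    (hp : p.Prime) {P : Ideal (𝓞 K)} [P.IsPrime] (hpP : (p : 𝓞 K) ∈ P) {a c : ℤ}
    (hac : (a ^ 2 - D * c ^ 2).natAbs = p) : Submodule.IsPrincipal P := by
  have key : ∀ c : ℤ, (a ^ 2 - D * c ^ 2).natAbs = p → (a : 𝓞 K) + c * s ∈ P →
      Submodule.IsPrincipal P := by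
    intro c hc hmem
    have hN : (Ideal.span {(a : 𝓞 K) + c * s}).absNorm = p := by
      rw [Ideal.absNorm_span_singleton, norm_add_mul h0 h1 hs, hc]
    have hprime : (Ideal.span {(a : 𝓞 K) + c * s}).IsPrime :=
      Ideal.isPrime_of_irreducible_absNorm (hN ▸ hp)
    have hmax := hprime.isMaximal fun h ↦ hp.ne_zero (by rw [← hN, h, Ideal.absNorm_bot])
    exact ⟨_, (hmax.eq_of_le ‹P.IsPrime›.ne_top
      ((Ideal.span_singleton_le_iff_mem P).mpr hmem)).symm⟩
  have hmul : ((a : 𝓞 K) + c * s) * (a + (-c : ℤ) * s) ∈ P := by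
    have e : ((a : 𝓞 K) + c * s) * (a + (-c : ℤ) * s) = ((a ^ 2 - D * c ^ 2 : ℤ) : 𝓞 K) := by
      push_cast
      rw [← hs]
      ring
    rw [e]
    have hpP' : ((p : ℤ) : 𝓞 K) ∈ P := by exact_mod_cast hpP
    obtain ⟨k, hk⟩ : (p : ℤ) ∣ a ^ 2 - D * c ^ 2 := Int.natCast_dvd.mpr (dvd_of_eq hac.symm)
    rw [hk, Int.cast_mul]
    exact P.mul_mem_right _ hpP'
  rcases ‹P.IsPrime›.mem_or_mem hmul with h | h
  · exact key c hac h
  · exact key (-c) (by rwa [neg_sq]) h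

theorem exists_sq_eq_of_absNorm_eq (hs : s ^ 2 = D) {p : ℕ} (hp : p.Prime) {P : Ideal (𝓞 K)}
    (hP : P.absNorm = p) : ∃ x : ZMod p, x ^ 2 = D := by
  rw [Ideal.absNorm_apply, Submodule.cardQuot_apply] at hP
  have : Finite (𝓞 K ⧸ P) := Nat.finite_of_card_ne_zero (hP ▸ hp.ne_zero)
  have := Fintype.ofFinite (𝓞 K ⧸ P)
  let e := ZMod.ringEquivOfPrime (𝓞 K ⧸ P) hp (by rwa [← Nat.card_eq_fintype_card])
  refine ⟨e.symm (Ideal.Quotient.mk P s), ?_⟩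
  rw [← map_pow, ← map_pow, hs, map_natCast, map_natCast]

/-- A criterion for a real quadratic field generated by `√D` to have class number one: each prime
`p ≤ √D` is, up to sign, of the form `a² - D c²`, or is inert with `√D < p²`. -/
theorem isPrincipalIdealRing (h0 : b 0 = 1) (h1 : b 1 = s) (hs : s ^ 2 = D) (hD : 0 < D)
    (φ : K →+* ℝ) (h : ∀ p : ℕ, p.Prime → p ^ 2 ≤ D →
      (∃ a c : ℤ, (a ^ 2 - D * c ^ 2).natAbs = p) ∨ ((∀ x : ZMod p, x ^ 2 ≠ D) ∧ D < p ^ 4)) :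
    IsPrincipalIdealRing (𝓞 K) := by
  have hM : (4 / Real.pi) ^ InfinitePlace.nrComplexPlaces K *
      (((Module.finrank ℚ K).factorial : ℝ) / (Module.finrank ℚ K : ℝ) ^ Module.finrank ℚ K *
        √|(discr K : ℝ)|) ≤ √D := by
    rw [nrComplexPlaces_eq_zero b φ, finrank_eq_two b]
    have hd : |(discr K : ℝ)| ≤ 2 ^ 2 * D := by
      have := abs_discr_le h0 h1 hs hD
      norm_num
      exact_mod_cast this
    have := Real.sqrt_le_sqrt hd
    rw [Real.sqrt_mul (by positivity), Real.sqrt_sq (by norm_num)] at this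
    norm_num [Nat.factorial]
    linarith
  have hle : ∀ n : ℕ, n ≤ ⌊√(D : ℝ)⌋₊ → n ^ 2 ≤ D := by
    intro n hn
    rw [Real.nat_floor_real_sqrt_eq_nat_sqrt] at hn
    exact Nat.le_sqrt'.mp hn
  refine RingOfIntegers.isPrincipalIdealRing_of_isPrincipal_of_pow_le_of_mem_primesOver_of_mem_Icc
    fun p hpM hp P hP hPM ↦ ?_
  obtain ⟨hPprime, hPover⟩ := hP
  replace hpM := hle p ((Finset.mem_Icc.mp hpM).2.trans (Nat.floor_le_floor hM))
  replace hPM := hle _ (hPM.trans (Nat.floor_le_floor hM))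
  rcases h p hp hpM with ⟨a, c, hac⟩ | ⟨hns, hlt⟩
  · have hmem : (p : 𝓞 K) ∈ P := by
      have := (Ideal.mem_of_liesOver P (Ideal.span {(p : ℤ)}) p).mp
        (Ideal.mem_span_singleton_self _)
      simpa using this
    exact isPrincipal_of_norm_eq h0 h1 hs hp hmem hac
  · have : (Ideal.span {(p : ℤ)}).IsMaximal :=
      ((Ideal.span_singleton_prime (by simpa using hp.ne_zero)).mpr
        (Nat.prime_iff_prime_int.mp hp)).isMaximal (by simpa using hp.ne_zero)
    have hPbot : P ≠ ⊥ := Ideal.ne_bot_of_liesOver_of_ne_bot (p := Ideal.span {(p : ℤ)})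
      (by simpa using hp.ne_zero) P
    have := hPprime.isMaximal hPbot
    have hN := Ideal.natAbs_pow_inertiaDeg (p : ℤ) P
    rw [Int.natAbs_natCast] at hN
    have hf : P.inertiaDeg ℤ < 2 := by
      rw [← pow_mul] at hPM
      have := (Nat.pow_lt_pow_iff_right hp.one_lt).mp (hPM.trans_lt hlt)
      omega
    interval_cases hd : P.inertiaDeg ℤ
    · exact absurd (Ideal.absNorm_eq_one_iff.mp (by simpa using hN.symm)) hPprime.ne_top
    · obtain ⟨x, hx⟩ := exists_sq_eq_of_absNorm_eq hs hp (P := P) (by simpa using hN.symm)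
      exact absurd hx (hns x)

end QuadraticBasis

theorem minpoly_sqrt_prime {q : ℕ} (hq : q.Prime) :
    minpoly ℚ (Real.sqrt q) = X ^ 2 - C (q : ℚ) := by
  refine (minpoly.eq_of_irreducible_of_monic ?_ ?_ (by monicity!)).symm
  · refine X_pow_sub_C_irreducible_of_prime Nat.prime_two fun r hr ↦ ?_
    refine (irrational_sqrt_natCast_iff.mp hq.irrational_sqrt) ?_
    exact Rat.isSquare_natCast_iff.mp ⟨r, by rw [← hr, sq]⟩
  · simp [Real.sq_sqrt (by positivity : (0 : ℝ) ≤ (q : ℝ))]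

theorem isPrincipalIdealRing_adjoin_sqrt_prime {q : ℕ} (hq : q.Prime)
    (h : ∀ p : ℕ, p.Prime → p ^ 2 ≤ q →
      (∃ a c : ℤ, (a ^ 2 - q * c ^ 2).natAbs = p) ∨ ((∀ x : ZMod p, x ^ 2 ≠ q) ∧ q < p ^ 4)) :
    IsPrincipalIdealRing (𝓞 ℚ⟮Real.sqrt q⟯) := by
  have hdim : (adjoin.powerBasis (sqrtNat_isIntegral q)).dim = 2 := by
    rw [adjoin.powerBasis_dim, minpoly_sqrt_prime hq, natDegree_X_pow_sub_C]
  let g := AdjoinSimple.gen ℚ (Real.sqrt q)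
  have hg : g ^ 2 = q := by
    apply Subtype.ext
    simp [g, Real.sq_sqrt (by positivity : (0 : ℝ) ≤ (q : ℝ))]
  have hg_int : IsIntegral ℤ g :=
    ⟨X ^ 2 - C (q : ℤ), by monicity!, by simp [hg]⟩
  let s : 𝓞 ℚ⟮Real.sqrt q⟯ := ⟨g, hg_int⟩
  have hsg : (s : ℚ⟮Real.sqrt q⟯) = g := rfl
  let b := (adjoin.powerBasis (sqrtNat_isIntegral q)).basis.reindex (finCongr hdim)
  refine QuadraticBasis.isPrincipalIdealRing (b := b) (s := s) (D := q) ?_ ?_ ?_ hq.pos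
    (ℚ⟮Real.sqrt q⟯).val.toRingHom h
  · simp [b]
  · simp [b, hsg, g]
  · apply RingOfIntegers.coe_injective
    rw [map_pow, map_natCast]
    exact hg

/-- For each `D ∈ {2, 3, 7, 11, 19, 43, 67}`, the class number of the real quadratic
field `ℚ(√D)` is `1`, i.e. the ideal class group of its ring of integers is trivial. -/
theorem classNumber_eq_one_of_mem :
    ∀ D ∈ ({2, 3, 7, 11, 19, 43, 67} : Finset ℕ),
      NumberField.classNumber ℚ⟮Real.sqrt D⟯ = 1 ∧
      ∀ C : ClassGroup (𝓞 ℚ⟮Real.sqrt D⟯), C = 1 := by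
  intro D hD
  suffices h : IsPrincipalIdealRing (𝓞 ℚ⟮Real.sqrt D⟯) from
    ⟨classNumber_eq_one_iff.mpr h, fun _ ↦ Subsingleton.elim _ _⟩
  have hq : D.Prime := by
    simp only [Finset.mem_insert, Finset.mem_singleton] at hD
    rcases hD with rfl | rfl | rfl | rfl | rfl | rfl | rfl <;> norm_num
  refine isPrincipalIdealRing_adjoin_sqrt_prime hq fun p hp hpD ↦ ?_
  have hp8 : p ≤ 8 := by
    have : D ≤ 67 := by
      simp only [Finset.mem_insert, Finset.mem_singleton] at hD
      omega
    nlinarith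
  simp only [Finset.mem_insert, Finset.mem_singleton] at hD
  have hp' : p = 2 ∨ p = 3 ∨ p = 5 ∨ p = 7 := by
    interval_cases p <;> revert hp <;> norm_num
  rcases hp' with rfl | rfl | rfl | rfl
  · left
    rcases hD with rfl | rfl | rfl | rfl | rfl | rfl | rfl
    · exact ⟨0, 1, rfl⟩
    · exact ⟨1, 1, rfl⟩
    · exact ⟨3, 1, rfl⟩
    · exact ⟨3, 1, rfl⟩
    · exact ⟨13, 3, rfl⟩
    · exact ⟨59, 9, rfl⟩
    · exact ⟨221, 27, rfl⟩
  · rcases hD with rfl | rfl | rfl | rfl | rfl | rfl | rfl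
    · omega
    · omega
    · omega
    · exact .inr ⟨by decide, by norm_num⟩
    · exact .inl ⟨4, 1, rfl⟩
    · exact .inl ⟨13, 2, rfl⟩
    · exact .inl ⟨8, 1, rfl⟩
  · rcases hD with rfl | rfl | rfl | rfl | rfl | rfl | rfl
    iterate 5 omega
    · exact .inr ⟨by decide, by norm_num⟩
    · exact .inr ⟨by decide, by norm_num⟩
  · rcases hD with rfl | rfl | rfl | rfl | rfl | rfl | rfl
    iterate 6 omega
    exact .inl ⟨90, 11, rfl⟩
end

section
/- The ideal class group of the ring of integers of the real quadratic field ℚ(√35) is isomorphic to ℤ/2ℤ, and the ideal class group of the ring of integers of the imaginary quadratic field ℚ(√-35) is also isomorphic to ℤ/2ℤ. -/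
open NumberField IntermediateField Polynomial

namespace QuadraticField

open nonZeroDivisors Ideal

theorem trace_and_norm_smul_one_add_smul {K : Type*} [Field K] [Algebra ℚ K]
    (b : Module.Basis (Fin 2) ℚ K) (h0 : b 0 = 1) (d : ℚ) (h1 : b 1 ^ 2 = algebraMap ℚ K d) (x y : ℚ) :
    Algebra.trace ℚ K (x • 1 + y • b 1) = 2 * x ∧
      Algebra.norm ℚ (x • 1 + y • b 1) = x ^ 2 - d * y ^ 2 := by
  have e0 : (x • 1 + y • b 1) * b 0 = x • b 0 + y • b 1 := by rw [h0]; simp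
  have e1 : (x • 1 + y • b 1) * b 1 = (d * y) • b 0 + x • b 1 := by
    rw [h0, add_mul, smul_mul_assoc, smul_mul_assoc, one_mul, ← sq, h1]
    simp only [Algebra.smul_def, map_mul]; ring
  rw [Algebra.trace_eq_matrix_trace b, Algebra.norm_eq_matrix_det b,
    Matrix.trace_fin_two, Matrix.det_fin_two]
  simp only [Algebra.leftMulMatrix_eq_repr_mul, e0, e1, map_add, map_smul,
    Module.Basis.repr_self, Finsupp.add_apply, Finsupp.smul_apply, Finsupp.single_apply]
  constructor <;> norm_num <;> ring

theorem eq_zero_of_add_mul_eq_zero {F L : Type*} [Field F] [Field L] [Algebra F L] {α : L} {d : F}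
    (hd : ∀ r : F, r ^ 2 ≠ d) (h : α ^ 2 = algebraMap F L d) {s t : F}
    (hst : algebraMap F L s + algebraMap F L t * α = 0) : s = 0 ∧ t = 0 := by
  have ht : t = 0 := by
    by_contra ht
    apply hd (s / t)
    apply (algebraMap F L).injective
    have ht' : algebraMap F L t ≠ 0 := (_root_.map_ne_zero _).mpr ht
    rw [map_pow, map_div₀, ← h, div_pow, div_eq_iff (pow_ne_zero 2 ht'),
      eq_neg_of_add_eq_zero_left hst]
    ring
  subst ht
  simpa using hst

theorem exists_basis_adjoin_of_sq_eq {L : Type*} [Field L] [Algebra ℚ L] (α : L) (d : ℚ)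
    (hd : ∀ r : ℚ, r ^ 2 ≠ d) (h : α ^ 2 = algebraMap ℚ L d) :
    ∃ b : Module.Basis (Fin 2) ℚ ℚ⟮α⟯, b 0 = 1 ∧ b 1 ^ 2 = algebraMap ℚ ℚ⟮α⟯ d := by
  have hm : minpoly ℚ α = X ^ 2 - C d := by
    symm
    apply minpoly.eq_of_irreducible_of_monic (X_pow_sub_C_irreducible_of_prime Nat.prime_two hd)
    · simp [h]
    · monicity!
  have hi : IsIntegral ℚ α := ⟨X ^ 2 - C d, by monicity!, by simp [h]⟩
  have hf : Module.finrank ℚ ℚ⟮α⟯ = 2 := by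
    rw [adjoin.finrank hi, hm]; compute_degree!
  have hl : LinearIndependent ℚ ![(1 : ℚ⟮α⟯), AdjoinSimple.gen ℚ α] := by
    rw [LinearIndependent.pair_iff]
    intro s t hst
    replace hst := congrArg (algebraMap ℚ⟮α⟯ L) hst
    exact eq_zero_of_add_mul_eq_zero hd h (by simpa [Algebra.smul_def] using hst)
  exact ⟨basisOfLinearIndependentOfCardEqFinrank hl (by simp [hf]), by simp, by
    apply Subtype.ext
    simp [h]⟩

variable {K : Type*} [Field K] [NumberField K]

theorem dvd_of_intCast_mem {I : Ideal (𝓞 K)} {p : ℕ} (hp : p.Prime) (hI : absNorm I = p) {m : ℤ}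
    (hm : (m : 𝓞 K) ∈ I) : (p : ℤ) ∣ m := by
  by_contra h
  obtain ⟨a, b, hab⟩ := (Nat.prime_iff_prime_int.mp hp).coprime_iff_not_dvd.mpr h
  have h1 : (1 : 𝓞 K) ∈ I := by
    have hpI : (p : 𝓞 K) ∈ I := hI ▸ absNorm_mem I
    have := I.add_mem (I.mul_mem_left (a : 𝓞 K) hpI) (I.mul_mem_left (b : 𝓞 K) hm)
    have e : (a : 𝓞 K) * p + b * m = 1 := by exact_mod_cast congrArg (Int.cast : ℤ → 𝓞 K) hab
    rwa [e] at this
  rw [(Ideal.eq_top_iff_one I).mpr h1, absNorm_top] at hI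
  exact hp.one_lt.ne hI

/-- Modulo an ideal of prime norm `p`, every integral element is congruent to an integer in `[0, p)`. -/
theorem exists_sub_intCast_mem {I : Ideal (𝓞 K)} {p : ℕ} (hp : p.Prime) (hI : absNorm I = p)
    {θ : 𝓞 K} {t n : ℤ} (hθ : θ ^ 2 = t * θ - n) :
    ∃ r : ℤ, 0 ≤ r ∧ r < p ∧ θ - r ∈ I ∧ (p : ℤ) ∣ r ^ 2 - t * r + n := by
  have hc : Nat.card (𝓞 K ⧸ I) = p := hI
  have : Finite (𝓞 K ⧸ I) := Nat.finite_of_card_ne_zero (hc ▸ hp.ne_zero)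
  have := Fintype.ofFinite (𝓞 K ⧸ I)
  have : NeZero p := ⟨hp.ne_zero⟩
  let e := ZMod.ringEquivOfPrime (𝓞 K ⧸ I) hp (by rw [← Nat.card_eq_fintype_card, hc])
  have hr : θ - ((e.symm (Ideal.Quotient.mk I θ)).val : ℤ) ∈ I := by
    rw [← Ideal.Quotient.eq_zero_iff_mem, map_sub, map_intCast, Int.cast_natCast,
      ← map_natCast e, ZMod.natCast_zmod_val, e.apply_symm_apply, sub_self]
  refine ⟨_, by positivity, by exact_mod_cast ZMod.val_lt _, hr, dvd_of_intCast_mem hp hI ?_⟩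
  set r : ℤ := ((e.symm (Ideal.Quotient.mk I θ)).val : ℤ)
  have e : ((r ^ 2 - t * r + n : ℤ) : 𝓞 K) = (t - θ - r) * (θ - r) := by
    push_cast
    linear_combination hθ
  exact e ▸ I.mul_mem_left _ hr

theorem eq_of_le_of_absNorm_eq {I J : Ideal (𝓞 K)} (h : J ≤ I) (hJ : absNorm J ≠ 0)
    (hn : absNorm J = absNorm I) : I = J := by
  obtain ⟨A, rfl⟩ := Ideal.dvd_iff_le.mpr h
  rw [map_mul] at hn
  have : absNorm A = 1 := by
    refine Nat.eq_of_mul_eq_mul_left (Nat.pos_of_ne_zero fun h0 ↦ hJ ?_) (hn.trans (mul_one _).symm)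
    rw [map_mul, h0, zero_mul]
  rw [absNorm_eq_one_iff.mp this, Ideal.mul_top]

theorem absNorm_eq_of_mul_self {I : Ideal (𝓞 K)} {p : ℕ} (hK : Module.finrank ℚ K = 2)
    (h : I * I = span {(p : 𝓞 K)}) : absNorm I = p := by
  have := congrArg absNorm h
  rw [map_mul, absNorm_span_natCast, RingOfIntegers.rank, hK, ← sq] at this
  exact Nat.pow_left_injective two_ne_zero this

theorem mk0_mul_mk0_eq_one {I J : (Ideal (𝓞 K))⁰} {x : 𝓞 K}
    (h : (I : Ideal (𝓞 K)) * J = span {x}) : ClassGroup.mk0 I * ClassGroup.mk0 J = 1 := by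
  rw [← map_mul]
  exact (ClassGroup.mk0_eq_one_iff (I * J).2).mpr ⟨x, h⟩

/-- The discriminant of a quadratic field is bounded by that of any integral element `θ`. -/
theorem abs_discr_le {θ : 𝓞 K} {t n : ℤ} (hK : Module.finrank ℚ K = 2) (hθ : θ ^ 2 = t * θ - n)
    (ht : Algebra.trace ℚ K θ = t) (h0 : t ^ 2 - 4 * n ≠ 0) : |discr K| ≤ |t ^ 2 - 4 * n| := by
  have ht' : Algebra.trace ℤ (𝓞 K) θ = t := by
    have := Algebra.coe_trace_int θ
    rw [ht] at this
    exact_mod_cast this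
  have h1 : Algebra.trace ℤ (𝓞 K) 1 = 2 := by
    have := Algebra.trace_algebraMap (S := 𝓞 K) (1 : ℤ)
    simpa [RingOfIntegers.rank, hK] using this
  have h2 : Algebra.trace ℤ (𝓞 K) (θ ^ 2) = t ^ 2 - 2 * n := by
    have e : θ ^ 2 = t • θ - n • (1 : 𝓞 K) := by rw [hθ]; simp
    rw [e, map_sub, map_smul, map_smul, ht', h1]
    simp only [smul_eq_mul]; ring
  have hd : Algebra.discr ℤ ![1, θ] = t ^ 2 - 4 * n := by
    rw [Algebra.discr_def, Matrix.det_fin_two]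
    simp [Algebra.traceMatrix_apply, Algebra.traceForm_apply, ← sq, h1, ht', h2]
    ring
  have hcard : Fintype.card (Module.Free.ChooseBasisIndex ℤ (𝓞 K)) = 2 := by
    rw [← Module.finrank_eq_card_chooseBasisIndex, RingOfIntegers.rank, hK]
  let b := (RingOfIntegers.basis K).reindex (Fintype.equivFinOfCardEq hcard)
  have hb : (b.toMatrix ![1, θ]).det ^ 2 * discr K = t ^ 2 - 4 * n := by
    rw [← discr_eq_discr K b, ← hd, ← Algebra.discr_of_matrix_vecMul, Module.Basis.toMatrix_map_vecMul]
  rw [← hb, abs_mul, abs_sq]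
  have : (b.toMatrix ![1, θ]).det ^ 2 ≠ 0 := fun h ↦ h0 (by rw [← hb, h, zero_mul])
  have : 0 < (b.toMatrix ![1, θ]).det ^ 2 := by positivity
  nlinarith [abs_nonneg (discr K)]

theorem nrRealPlaces_pos_of_ringHom_real (φ : K →+* ℝ) : 0 < InfinitePlace.nrRealPlaces K := by
  have : (InfinitePlace.mk (Complex.ofRealHom.comp φ)).IsReal := by
    rw [InfinitePlace.isReal_mk_iff, ComplexEmbedding.isReal_iff]
    ext x
    simp
  classical exact Fintype.card_pos_iff.mpr ⟨⟨_, this⟩⟩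

theorem nonempty_mulEquiv_zmod_two {K : Type*} [Field K] {c : ClassGroup (𝓞 K)} (hc : c ≠ 1)
    (h : ∀ x, x = 1 ∨ x = c) :
    Nonempty (ClassGroup (𝓞 K) ≃* Multiplicative (ZMod 2)) := by
  have h2 : Nat.card (ClassGroup (𝓞 K)) = 2 :=
    (Nat.card_eq_two_iff' 1).mpr ⟨c, hc, fun y hy ↦ (h y).resolve_left hy⟩
  exact ⟨mulEquivOfPrimeCardEq (p := 2) h2 (by simp)⟩

/-- The norm of an algebraic integer in `ℚ(√d)` in terms of the integral traces of `x` and `x√d`. -/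
theorem four_mul_norm_eq (b : Module.Basis (Fin 2) ℚ K) (h0 : b 0 = 1) {d : ℤ} {θ : 𝓞 K}
    (hθ : (θ : K) = b 1) (h1 : θ ^ 2 = d) (x : 𝓞 K) :
    4 * d * Algebra.norm ℤ x =
      d * Algebra.trace ℤ (𝓞 K) x ^ 2 - Algebra.trace ℤ (𝓞 K) (x * θ) ^ 2 := by
  have h1' : b 1 ^ 2 = algebraMap ℚ K d := by
    rw [← hθ, ← map_pow, h1]; simp
  obtain ⟨u, v, hx⟩ : ∃ u v : ℚ, (x : K) = u • 1 + v • b 1 :=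
    ⟨_, _, by rw [← h0, ← Fin.sum_univ_two fun i ↦ b.repr x i • b i, b.sum_repr]⟩
  have hxθ : ((x * θ : 𝓞 K) : K) = (d * v) • 1 + u • b 1 := by
    rw [show ((x * θ : 𝓞 K) : K) = (x : K) * θ from map_mul _ _ _, hx, hθ, add_mul,
      smul_mul_assoc, smul_mul_assoc, one_mul, ← sq, h1']
    simp only [Algebra.smul_def, map_mul]; ring
  have e1 := (trace_and_norm_smul_one_add_smul b h0 _ h1' u v)
  have e2 := (trace_and_norm_smul_one_add_smul b h0 _ h1' (d * v) u).1
  rw [← hx] at e1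
  rw [← hxθ] at e2
  rw [← @Int.cast_inj ℚ]
  push_cast
  rw [Algebra.coe_norm_int, Algebra.coe_trace_int, Algebra.coe_trace_int, e1.1, e1.2, e2]
  ring

/-- By Minkowski's bound the class group of `ℚ(√35)` is represented by ideals of norm at most `5`; it
is generated by the ramified prime above `2`. -/
theorem nonempty_classGroup_mulEquiv_of_sq_eq_thirtyFive (b : Module.Basis (Fin 2) ℚ K) (h0 : b 0 = 1)
    (hb : b 1 ^ 2 = 35) (φ : K →+* ℝ) :
    Nonempty (ClassGroup (𝓞 K) ≃* Multiplicative (ZMod 2)) := by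
  obtain ⟨θ, hθ⟩ : ∃ θ : 𝓞 K, (θ : K) = b 1 :=
    ⟨⟨b 1, X ^ 2 - C 35, by monicity!, by simp [hb]⟩, rfl⟩
  have h1 : θ ^ 2 = 35 :=
    RingOfIntegers.coe_injective (by rw [map_pow, map_ofNat, ← hb, ← hθ])
  have hK : Module.finrank ℚ K = 2 := by simp [Module.finrank_eq_card_basis b]
  have htr : Algebra.trace ℚ K θ = (0 : ℤ) := by
    have := (trace_and_norm_smul_one_add_smul b h0 35 (by rw [hb, map_ofNat]) 0 1).1
    simpa [hθ] using this
  have hD : |discr K| ≤ 140 := by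
    have := abs_discr_le (n := -35) hK (by rw [h1]; simp) htr (by norm_num)
    simpa using this
  have hr2 : InfinitePlace.nrComplexPlaces K = 0 := by
    have := InfinitePlace.card_add_two_mul_card_eq_rank K
    have := nrRealPlaces_pos_of_ringHom_real φ
    omega
  have hbound (C : ClassGroup (𝓞 K)) :
      ∃ I : (Ideal (𝓞 K))⁰, ClassGroup.mk0 I = C ∧ absNorm (I : Ideal (𝓞 K)) ≤ 5 := by
    obtain ⟨I, hI, hle⟩ := exists_ideal_in_class_of_norm_le C
    refine ⟨I, hI, Nat.lt_succ_iff.mp ?_⟩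
    rw [hr2, hK] at hle
    have hs : √|(discr K : ℝ)| < 12 := by
      rw [Real.sqrt_lt' (by norm_num)]
      have : |(discr K : ℝ)| ≤ 140 := by exact_mod_cast hD
      linarith
    have : (absNorm (I : Ideal (𝓞 K)) : ℝ) < 6 := by
      refine hle.trans_lt ?_
      norm_num [Nat.factorial]
      linarith
    exact_mod_cast this
  set P : Ideal (𝓞 K) := span {2, θ - 1} with hP
  set Q : Ideal (𝓞 K) := span {5, θ} with hQ
  have h2P : 2 ∈ P := subset_span (by simp)
  have hθP : θ - 1 ∈ P := subset_span (by simp)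
  have h5Q : 5 ∈ Q := subset_span (by simp)
  have hθQ : θ ∈ Q := subset_span (by simp)
  have hPP : P * P = span {2} := by
    apply le_antisymm
    · rw [hP, span_pair_mul_span_pair, span_le]
      rintro x (rfl | rfl | rfl | rfl) <;> rw [SetLike.mem_coe, mem_span_singleton]
      · exact ⟨2, rfl⟩
      · exact ⟨θ - 1, rfl⟩
      · exact ⟨θ - 1, mul_comm _ _⟩
      · exact ⟨18 - θ, by linear_combination h1⟩
    · rw [span_singleton_le_iff_mem,
        show (2 : 𝓞 K) = (θ - 1) * (θ - 1) + 2 * (θ - 1) - 8 * (2 * 2) by linear_combination - h1]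
      exact sub_mem (add_mem (mul_mem_mul hθP hθP) (mul_mem_mul h2P hθP))
        (mul_mem_left _ _ (mul_mem_mul h2P h2P))
  have hQQ : Q * Q = span {5} := by
    apply le_antisymm
    · rw [hQ, span_pair_mul_span_pair, span_le]
      rintro x (rfl | rfl | rfl | rfl) <;> rw [SetLike.mem_coe, mem_span_singleton]
      · exact ⟨5, rfl⟩
      · exact ⟨θ, rfl⟩
      · exact ⟨θ, mul_comm _ _⟩
      · exact ⟨7, by linear_combination h1⟩
    · rw [span_singleton_le_iff_mem,
        show (5 : 𝓞 K) = 3 * (5 * 5) - 2 * (θ * θ) by linear_combination 2 * h1]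
      exact sub_mem (mul_mem_left _ _ (mul_mem_mul h5Q h5Q))
        (mul_mem_left _ _ (mul_mem_mul hθQ hθQ))
  have hQP : Q * P = span {θ + 5} := by
    apply le_antisymm
    · rw [hP, hQ, span_pair_mul_span_pair, span_le]
      rintro x (rfl | rfl | rfl | rfl) <;> rw [SetLike.mem_coe, mem_span_singleton]
      · exact ⟨θ - 5, by linear_combination -h1⟩
      · exact ⟨20 - 3 * θ, by linear_combination 3 * h1⟩
      · exact ⟨7 - θ, by linear_combination h1⟩
      · exact ⟨4 * θ - 21, by linear_combination -3 * h1⟩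
    · rw [span_singleton_le_iff_mem,
        show θ + 5 = 4 * (5 * 2) - θ * (θ - 1) by linear_combination h1]
      exact sub_mem (mul_mem_left _ _ (mul_mem_mul h5Q h2P)) (mul_mem_mul hθQ hθP)
  have hnP : absNorm P = 2 := absNorm_eq_of_mul_self hK (by exact_mod_cast hPP)
  have hnQ : absNorm Q = 5 := absNorm_eq_of_mul_self hK (by exact_mod_cast hQQ)
  have hP0 : P ∈ (Ideal (𝓞 K))⁰ := mem_nonZeroDivisors_of_ne_zero fun h ↦ by simp [h] at hnP
  have hQ0 : Q ∈ (Ideal (𝓞 K))⁰ := mem_nonZeroDivisors_of_ne_zero fun h ↦ by simp [h] at hnQ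
  have hclPP : ClassGroup.mk0 ⟨P, hP0⟩ * ClassGroup.mk0 ⟨P, hP0⟩ = 1 := mk0_mul_mk0_eq_one hPP
  have hclQP : ClassGroup.mk0 ⟨Q, hQ0⟩ * ClassGroup.mk0 ⟨P, hP0⟩ = 1 := mk0_mul_mk0_eq_one hQP
  have hsq : θ ^ 2 = (0 : ℤ) * θ - (-35 : ℤ) := by rw [h1]; simp
  have eq_P {I : Ideal (𝓞 K)} (hI : absNorm I = 2) : I = P := by
    obtain ⟨r, hr0, hr, hθI, hdvd⟩ := exists_sub_intCast_mem Nat.prime_two hI hsq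
    refine eq_of_le_of_absNorm_eq ?_ (by rw [hnP]; norm_num) (hnP.trans hI.symm)
    have h2 : (2 : 𝓞 K) ∈ I := by simpa [hI] using absNorm_mem I
    push_cast at hr
    interval_cases r
    · omega
    · rw [hP, span_le]
      rintro x (rfl | rfl)
      · exact h2
      · simpa using hθI
  have ne_three (I : Ideal (𝓞 K)) : absNorm I ≠ 3 := fun hI ↦ by
    obtain ⟨r, hr0, hr, hθI, hdvd⟩ := exists_sub_intCast_mem Nat.prime_three hI hsq
    push_cast at hr
    interval_cases r <;> omega
  have eq_Q {I : Ideal (𝓞 K)} (hI : absNorm I = 5) : I = Q := by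
    obtain ⟨r, hr0, hr, hθI, hdvd⟩ := exists_sub_intCast_mem Nat.prime_five hI hsq
    refine eq_of_le_of_absNorm_eq ?_ (by rw [hnQ]; norm_num) (hnQ.trans hI.symm)
    have h5 : (5 : 𝓞 K) ∈ I := by simpa [hI] using absNorm_mem I
    push_cast at hr
    interval_cases r <;> try omega
    rw [hQ, span_le]
    rintro x (rfl | rfl)
    · exact h5
    · simpa using hθI
  have not_prime {I : Ideal (𝓞 K)} (hI : absNorm I = 4) (hp : I.IsPrime) : False := by
    have h4 : (2 : 𝓞 K) ^ 2 ∈ I := by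
      have := absNorm_mem I
      rw [hI] at this
      convert this using 1
      norm_num
    have h2 := hp.mem_of_pow_mem _ h4
    have hθI : θ - 1 ∈ I := by
      refine hp.mem_of_pow_mem 2 ?_
      rw [show (θ - 1) ^ 2 = (18 - θ) * 2 by linear_combination h1]
      exact I.mul_mem_left _ h2
    have hle : P ≤ I := by
      rw [hP, span_le]
      rintro x (rfl | rfl)
      exacts [h2, hθI]
    have := map_dvd absNorm (dvd_iff_le.mpr hle)
    rw [hI, hnP] at this
    omega
  have eq_PP {I : Ideal (𝓞 K)} (hI : absNorm I = 4) : I = P * P := by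
    obtain ⟨M, hM, hIM⟩ := exists_le_maximal I fun h ↦ by simp [h] at hI
    obtain ⟨J, rfl⟩ := dvd_iff_le.mpr hIM
    rw [map_mul] at hI
    have hM1 : absNorm M ≠ 1 := fun h ↦ hM.ne_top (absNorm_eq_one_iff.mp h)
    have hM4 : absNorm M ≠ 4 := fun h ↦ not_prime h hM.isPrime
    have hM3 := ne_three M
    have hle : absNorm M ≤ 4 := Nat.le_of_dvd (by norm_num) ⟨_, hI.symm⟩
    have hM2 : absNorm M = 2 := by
      interval_cases absNorm M <;> omega
    rw [hM2] at hI
    rw [eq_P hM2, eq_P (I := J) (by omega)]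
  refine nonempty_mulEquiv_zmod_two (c := ClassGroup.mk0 ⟨P, hP0⟩) (fun h ↦ ?_) fun C ↦ ?_
  · obtain ⟨x, hx⟩ := (ClassGroup.mk0_eq_one_iff hP0).mp h
    have hN : (Algebra.norm ℤ x).natAbs = 2 := by
      rw [← absNorm_span_singleton, ← hnP]; exact congrArg absNorm hx.symm
    have key := four_mul_norm_eq b h0 hθ (d := 35) (by simpa using h1) x
    generalize Algebra.trace ℤ (𝓞 K) x = A at key
    generalize Algebra.trace ℤ (𝓞 K) (x * θ) = k at key
    obtain ⟨m, rfl⟩ : (35 : ℤ) ∣ k := by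
      have h5 : (5 : ℤ) ∣ k := (by norm_num : Prime (5 : ℤ)).dvd_of_dvd_pow (n := 2) (by omega)
      have h7 : (7 : ℤ) ∣ k := (by norm_num : Prime (7 : ℤ)).dvd_of_dvd_pow (n := 2) (by omega)
      omega
    have hA : A ^ 2 % 5 = 0 ∨ A ^ 2 % 5 = 1 ∨ A ^ 2 % 5 = 4 := by
      have : A % 5 = 0 ∨ A % 5 = 1 ∨ A % 5 = 2 ∨ A % 5 = 3 ∨ A % 5 = 4 := by omega
      rcases this with h | h | h | h | h <;> simp [pow_two, Int.mul_emod, h]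
    have : (35 * m) ^ 2 = 35 * (35 * m ^ 2) := by ring
    omega
  · obtain ⟨I, rfl, hI⟩ := hbound C
    obtain ⟨I, hI0⟩ := I
    have hne : absNorm I ≠ 0 := fun h ↦ nonZeroDivisors.ne_zero hI0 (absNorm_eq_zero_iff.mp h)
    have hI3 := ne_three I
    have : absNorm I = 1 ∨ absNorm I = 2 ∨ absNorm I = 4 ∨ absNorm I = 5 := by
      change absNorm I ≤ 5 at hI
      omega
    rcases this with h | h | h | h
    · left
      obtain rfl := absNorm_eq_one_iff.mp h
      exact (ClassGroup.mk0_eq_one_iff _).mpr top_isPrincipal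
    · right
      obtain rfl := eq_P h
      rfl
    · left
      obtain rfl := eq_PP h
      rw [← hclPP, ← map_mul]
      rfl
    · right
      obtain rfl := eq_Q h
      exact mul_right_cancel (hclQP.trans hclPP.symm)

/-- By Minkowski's bound the class group of `ℚ(√-35)` is represented by ideals of norm at most `3`;
it is generated by a prime above `3`. -/
theorem nonempty_classGroup_mulEquiv_of_sq_eq_neg_thirtyFive (b : Module.Basis (Fin 2) ℚ K) (h0 : b 0 = 1)
    (hb1 : b 1 ^ 2 = -35) : Nonempty (ClassGroup (𝓞 K) ≃* Multiplicative (ZMod 2)) := by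
  have hη : ((1 + b 1) / 2) ^ 2 = (1 + b 1) / 2 - 9 := by linear_combination hb1 / 4
  obtain ⟨ω, h⟩ : ∃ ω : 𝓞 K, (ω : K) = (1 + b 1) / 2 :=
    ⟨⟨(1 + b 1) / 2, X ^ 2 - X + C 9, by monicity!, by simp [hη]⟩, rfl⟩
  have hω : 2 * (ω : K) - 1 = b 1 := by rw [h]; ring
  have h1 : ω ^ 2 = ω - 9 :=
    RingOfIntegers.coe_injective (by
      rw [map_pow, map_sub, map_ofNat]
      change (ω : K) ^ 2 = ω - 9
      rw [h, hη])
  have hK : Module.finrank ℚ K = 2 := by simp [Module.finrank_eq_card_basis b]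
  have hθ : ((2 * ω - 1 : 𝓞 K) : K) = b 1 := by
    rw [← hω]
    simp [map_ofNat]
  have hθ2 : (2 * ω - 1) ^ 2 = ((-35 : ℤ) : 𝓞 K) := by
    push_cast
    linear_combination 4 * h1
  have hb : b 1 ^ 2 = algebraMap ℚ K (-35) := by rw [hb1, map_neg, map_ofNat]
  have hω' : (ω : K) = (2⁻¹ : ℚ) • 1 + (2⁻¹ : ℚ) • b 1 := by
    rw [← hω]
    simp only [Algebra.smul_def, map_inv₀, map_ofNat]
    ring
  have htr : Algebra.trace ℚ K ω = (1 : ℤ) := by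
    rw [hω', (trace_and_norm_smul_one_add_smul b h0 _ hb _ _).1]
    norm_num
  have hsq : ω ^ 2 = (1 : ℤ) * ω - (9 : ℤ) := by simpa using h1
  have hD : |discr K| ≤ 35 := by
    have := abs_discr_le hK hsq htr (by norm_num)
    simpa using this
  have hr2 : InfinitePlace.nrComplexPlaces K ≤ 1 := by
    have := InfinitePlace.card_add_two_mul_card_eq_rank K
    omega
  have hbound (C : ClassGroup (𝓞 K)) :
      ∃ I : (Ideal (𝓞 K))⁰, ClassGroup.mk0 I = C ∧ absNorm (I : Ideal (𝓞 K)) ≤ 3 := by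
    obtain ⟨I, hI, hle⟩ := exists_ideal_in_class_of_norm_le C
    refine ⟨I, hI, Nat.lt_succ_iff.mp ?_⟩
    rw [hK] at hle
    have hs : √|(discr K : ℝ)| < 6 := by
      rw [Real.sqrt_lt' (by norm_num)]
      have : |(discr K : ℝ)| ≤ 35 := by exact_mod_cast hD
      linarith
    have hpi : 1 ≤ 4 / Real.pi := by
      rw [one_le_div Real.pi_pos]
      exact Real.pi_le_four
    have hpi' : 4 / Real.pi < 4 / 3 :=
      div_lt_div_of_pos_left (by norm_num) (by norm_num) Real.pi_gt_three
    have hpow : (4 / Real.pi) ^ InfinitePlace.nrComplexPlaces K ≤ 4 / Real.pi := by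
      simpa using pow_le_pow_right₀ hpi hr2
    have : (absNorm (I : Ideal (𝓞 K)) : ℝ) < 4 := by
      refine hle.trans_lt ?_
      norm_num [Nat.factorial]
      nlinarith [Real.sqrt_nonneg |(discr K : ℝ)|]
    exact_mod_cast this
  set P : Ideal (𝓞 K) := span {3, ω} with hP
  set Q : Ideal (𝓞 K) := span {3, ω - 1} with hQ
  have h3P : 3 ∈ P := subset_span (by simp)
  have hωP : ω ∈ P := subset_span (by simp)
  have h3Q : 3 ∈ Q := subset_span (by simp)
  have hωQ : ω - 1 ∈ Q := subset_span (by simp)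
  have hPP : P * P = span {ω} := by
    apply le_antisymm
    · rw [hP, span_pair_mul_span_pair, span_le]
      rintro x (rfl | rfl | rfl | rfl) <;> rw [SetLike.mem_coe, mem_span_singleton]
      · exact ⟨1 - ω, by linear_combination h1⟩
      · exact ⟨3, mul_comm _ _⟩
      · exact ⟨3, rfl⟩
      · exact ⟨ω, rfl⟩
    · rw [span_singleton_le_iff_mem,
        show ω = ω * ω + 3 * 3 by linear_combination -h1]
      exact add_mem (mul_mem_mul hωP hωP) (mul_mem_mul h3P h3P)
  have hPQ : P * Q = span {3} := by
    apply le_antisymm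
    · rw [hP, hQ, span_pair_mul_span_pair, span_le]
      rintro x (rfl | rfl | rfl | rfl) <;> rw [SetLike.mem_coe, mem_span_singleton]
      · exact ⟨3, rfl⟩
      · exact ⟨ω - 1, rfl⟩
      · exact ⟨ω, mul_comm _ _⟩
      · exact ⟨-3, by linear_combination h1⟩
    · rw [span_singleton_le_iff_mem,
        show (3 : 𝓞 K) = ω * 3 - 3 * (ω - 1) by ring]
      exact sub_mem (mul_mem_mul hωP h3Q) (mul_mem_mul h3P hωQ)
  have hnP : absNorm P = 3 := by
    have hN : Algebra.norm ℤ ω = 9 := by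
      rw [← @Int.cast_inj ℚ, Algebra.coe_norm_int, hω',
        (trace_and_norm_smul_one_add_smul b h0 _ hb _ _).2]
      norm_num
    have := congrArg absNorm hPP
    rw [map_mul, absNorm_span_singleton, hN, ← sq] at this
    exact Nat.pow_left_injective two_ne_zero this
  have hnQ : absNorm Q = 3 := by
    have := congrArg absNorm hPQ
    rw [map_mul, hnP, ← Nat.cast_ofNat (R := 𝓞 K), absNorm_span_natCast, RingOfIntegers.rank, hK]
      at this
    omega
  have hP0 : P ∈ (Ideal (𝓞 K))⁰ := mem_nonZeroDivisors_of_ne_zero fun h ↦ by simp [h] at hnP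
  have hQ0 : Q ∈ (Ideal (𝓞 K))⁰ := mem_nonZeroDivisors_of_ne_zero fun h ↦ by simp [h] at hnQ
  have hclPP : ClassGroup.mk0 ⟨P, hP0⟩ * ClassGroup.mk0 ⟨P, hP0⟩ = 1 := mk0_mul_mk0_eq_one hPP
  have hclPQ : ClassGroup.mk0 ⟨P, hP0⟩ * ClassGroup.mk0 ⟨Q, hQ0⟩ = 1 := mk0_mul_mk0_eq_one hPQ
  have ne_two (I : Ideal (𝓞 K)) : absNorm I ≠ 2 := fun hI ↦ by
    obtain ⟨r, hr0, hr, hωI, hdvd⟩ := exists_sub_intCast_mem Nat.prime_two hI hsq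
    push_cast at hr
    interval_cases r <;> omega
  have eq_P_or_Q {I : Ideal (𝓞 K)} (hI : absNorm I = 3) : I = P ∨ I = Q := by
    obtain ⟨r, hr0, hr, hωI, hdvd⟩ := exists_sub_intCast_mem Nat.prime_three hI hsq
    have h3 : (3 : 𝓞 K) ∈ I := by simpa [hI] using absNorm_mem I
    push_cast at hr
    interval_cases r
    · refine .inl (eq_of_le_of_absNorm_eq ?_ (by rw [hnP]; norm_num) (hnP.trans hI.symm))
      rw [hP, span_le]
      rintro x (rfl | rfl)
      · exact h3
      · simpa using hωI
    · refine .inr (eq_of_le_of_absNorm_eq ?_ (by rw [hnQ]; norm_num) (hnQ.trans hI.symm))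
      rw [hQ, span_le]
      rintro x (rfl | rfl)
      · exact h3
      · simpa using hωI
    · omega
  refine nonempty_mulEquiv_zmod_two (c := ClassGroup.mk0 ⟨P, hP0⟩) (fun h ↦ ?_) fun C ↦ ?_
  · obtain ⟨x, hx⟩ := (ClassGroup.mk0_eq_one_iff hP0).mp h
    have hN : (Algebra.norm ℤ x).natAbs = 3 := by
      rw [← absNorm_span_singleton, ← hnP]; exact congrArg absNorm hx.symm
    have key := four_mul_norm_eq b h0 hθ hθ2 x
    generalize Algebra.trace ℤ (𝓞 K) x = A at key
    generalize Algebra.trace ℤ (𝓞 K) (x * (2 * ω - 1)) = k at key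
    obtain ⟨m, rfl⟩ : (35 : ℤ) ∣ k := by
      have h5 : (5 : ℤ) ∣ k := (by norm_num : Prime (5 : ℤ)).dvd_of_dvd_pow (n := 2) (by omega)
      have h7 : (7 : ℤ) ∣ k := (by norm_num : Prime (7 : ℤ)).dvd_of_dvd_pow (n := 2) (by omega)
      omega
    have hA : A ^ 2 % 5 = 0 ∨ A ^ 2 % 5 = 1 ∨ A ^ 2 % 5 = 4 := by
      have : A % 5 = 0 ∨ A % 5 = 1 ∨ A % 5 = 2 ∨ A % 5 = 3 ∨ A % 5 = 4 := by omega
      rcases this with h | h | h | h | h <;> simp [pow_two, Int.mul_emod, h]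
    have : (35 * m) ^ 2 = 35 * (35 * m ^ 2) := by ring
    omega
  · obtain ⟨I, rfl, hI⟩ := hbound C
    obtain ⟨I, hI0⟩ := I
    have hne : absNorm I ≠ 0 := fun h ↦ nonZeroDivisors.ne_zero hI0 (absNorm_eq_zero_iff.mp h)
    have hI2 := ne_two I
    have : absNorm I = 1 ∨ absNorm I = 3 := by
      change absNorm I ≤ 3 at hI
      omega
    rcases this with h | h
    · left
      obtain rfl := absNorm_eq_one_iff.mp h
      exact (ClassGroup.mk0_eq_one_iff _).mpr top_isPrincipal
    · right
      obtain rfl | rfl := eq_P_or_Q h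
      · rfl
      · exact mul_left_cancel (hclPQ.trans hclPP.symm)

theorem rat_sq_ne_of_int_sq_ne (d : ℤ) (hd : ∀ n : ℤ, n ^ 2 ≠ d) (r : ℚ) : r ^ 2 ≠ d := by
  intro h
  obtain ⟨n, rfl⟩ := (IsIntegrallyClosed.isIntegral_iff (R := ℤ) (x := r)).mp
    ⟨X ^ 2 - C d, by monicity!, by simp [-map_intCast, -eq_intCast, h]⟩
  rw [eq_intCast] at h
  exact hd n (mod_cast h)

end QuadraticField

/-- The ideal class group of the ring of integers of `ℚ(√35)` is isomorphic to
`ℤ/2ℤ`, and the ideal class group of the ring of integers of `ℚ(√-35)` is also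
isomorphic to `ℤ/2ℤ`. -/
theorem classGroup_sqrt35_and_sqrt_neg35 :
    Nonempty (ClassGroup (𝓞 ℚ⟮Real.sqrt (35 : ℕ)⟯) ≃* Multiplicative (ZMod 2)) ∧
    Nonempty (ClassGroup (𝓞 ℚ⟮(Real.sqrt (35 : ℕ) : ℂ) * Complex.I⟯) ≃*
      Multiplicative (ZMod 2)) := by
  constructor
  · have hsq : ∀ r : ℚ, r ^ 2 ≠ (35 : ℤ) :=
      QuadraticField.rat_sq_ne_of_int_sq_ne 35 fun n h ↦ by
        have : n < 6 := by nlinarith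
        have : -6 < n := by nlinarith
        interval_cases n <;> omega
    obtain ⟨b, h0, h1⟩ := QuadraticField.exists_basis_adjoin_of_sq_eq (Real.sqrt (35 : ℕ)) 35
      (mod_cast hsq)
      (by rw [Real.sq_sqrt (by positivity)]; simp)
    rw [map_ofNat] at h1
    exact QuadraticField.nonempty_classGroup_mulEquiv_of_sq_eq_thirtyFive b h0 h1 (algebraMap _ ℝ)
  · obtain ⟨b, h0, h1⟩ := QuadraticField.exists_basis_adjoin_of_sq_eq
      ((Real.sqrt (35 : ℕ) : ℂ) * Complex.I) (-35)
      (fun r h ↦ by nlinarith [sq_nonneg r])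
      (by
        rw [mul_pow, Complex.I_sq, ← Complex.ofReal_pow, Real.sq_sqrt (by positivity)]
        simp)
    rw [map_neg, map_ofNat] at h1
    exact QuadraticField.nonempty_classGroup_mulEquiv_of_sq_eq_neg_thirtyFive b h0 h1
end

section
/- The ideal class group of the ring of integers of the real quadratic field ℚ(√51) is isomorphic to ℤ/2ℤ, and the ideal class group of the ring of integers of the imaginary quadratic field ℚ(√-51) is also isomorphic to ℤ/2ℤ. -/
open NumberField IntermediateField Polynomial

section
variable {R A : Type*} [CommRing R] [CommRing A] [Algebra R A]

theorem repr_add_smul (b : Module.Basis (Fin 2) R A) (x y : R) (i : Fin 2) :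
    b.repr (x • b 0 + y • b 1) i = ![x, y] i := by
  fin_cases i <;> simp

theorem leftMulMatrix_of_mul_self {t n : R} (b : Module.Basis (Fin 2) R A) (h0 : b 0 = 1)
    (h1 : b 1 * b 1 = n • b 0 + t • b 1) (x y : R) :
    Algebra.leftMulMatrix b (x • b 0 + y • b 1) = !![x, n * y; y, x + t * y] := by
  have e0 : (x • b 0 + y • b 1) * b 0 = x • b 0 + y • b 1 := by rw [h0, mul_one]
  have e1 : (x • b 0 + y • b 1) * b 1 = (n * y) • b 0 + (x + t * y) • b 1 := by
    rw [add_mul, smul_mul_assoc, smul_mul_assoc, h1, h0]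
    simp only [Algebra.smul_def, map_add, map_mul]
    ring
  ext i j
  rw [Algebra.leftMulMatrix_eq_repr_mul]
  fin_cases j
  · simp only [Fin.zero_eta, e0, repr_add_smul]; fin_cases i <;> rfl
  · simp only [Fin.mk_one, e1, repr_add_smul]; fin_cases i <;> rfl

theorem trace_of_mul_self {t n : R} (b : Module.Basis (Fin 2) R A) (h0 : b 0 = 1)
    (h1 : b 1 * b 1 = n • b 0 + t • b 1) (x y : R) :
    Algebra.trace R A (x • b 0 + y • b 1) = 2 * x + t * y := by
  rw [Algebra.trace_eq_matrix_trace b, leftMulMatrix_of_mul_self b h0 h1, Matrix.trace_fin_two]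
  simp only [Matrix.of_apply, Matrix.cons_val]
  ring

theorem norm_of_mul_self {t n : R} (b : Module.Basis (Fin 2) R A) (h0 : b 0 = 1)
    (h1 : b 1 * b 1 = n • b 0 + t • b 1) (x y : R) :
    Algebra.norm R (x • b 0 + y • b 1) = x ^ 2 + t * x * y - n * y ^ 2 := by
  rw [Algebra.norm_eq_matrix_det b, leftMulMatrix_of_mul_self b h0 h1, Matrix.det_fin_two]
  simp only [Matrix.of_apply, Matrix.cons_val]
  ring

theorem discr_of_mul_self {t n : R} (b : Module.Basis (Fin 2) R A) (h0 : b 0 = 1)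
    (h1 : b 1 * b 1 = n • b 0 + t • b 1) : Algebra.discr R b = t ^ 2 + 4 * n := by
  have T := trace_of_mul_self b h0 h1
  have t0 := T 1 0
  have t1 := T 0 1
  have t2 := T n t
  rw [← h1] at t2
  simp only [one_smul, zero_smul, add_zero, zero_add, mul_one, mul_zero] at t0 t1
  have t3 : b 0 * b 0 = b 0 := by rw [h0, mul_one]
  have t4 : b 0 * b 1 = b 1 := by rw [h0, one_mul]
  have t5 : b 1 * b 0 = b 1 := by rw [h0, mul_one]
  rw [Algebra.discr_def, Matrix.det_fin_two]
  simp only [Algebra.traceMatrix_apply, Algebra.traceForm_apply, t0, t1, t2, t3, t4, t5]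
  ring

theorem exists_basis_fin_two (w : A) (hs : ∀ x : A, ∃ u v : R, x = u • 1 + v • w)
    (hi : ∀ u v : R, u • (1 : A) + v • w = 0 → u = 0 ∧ v = 0) :
    ∃ b : Module.Basis (Fin 2) R A, b 0 = 1 ∧ b 1 = w := by
  have li : LinearIndependent R ![(1 : A), w] := LinearIndependent.pair_iff.2 hi
  have sp : ⊤ ≤ Submodule.span R (Set.range ![(1 : A), w]) := by
    rintro x -
    obtain ⟨u, v, rfl⟩ := hs x
    rw [Matrix.range_cons, Matrix.range_cons, Matrix.range_empty, Set.union_empty]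
    exact Submodule.mem_span_pair.2 ⟨u, v, rfl⟩
  exact ⟨Module.Basis.mk li sp, by simp, by simp⟩
end

section
variable {K : Type*} [Field K] [NumberField K]

theorem exists_int_of_squarefree_mul_sq {d k : ℤ} (hd : Squarefree d) {q : ℚ}
    (h : d * q ^ 2 = (k : ℚ)) : ∃ b : ℤ, q = b := by
  have h1 : d * q.num ^ 2 = k * (q.den : ℤ) ^ 2 := by
    have h2 : (q.den : ℚ) ≠ 0 := by exact_mod_cast q.den_nz
    have h3 := q.num_div_den
    rw [← h3] at h
    field_simp at h
    rw [mul_comm k]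
    exact_mod_cast h
  have h4 : IsCoprime ((q.den : ℤ) ^ 2) (q.num ^ 2) := by
    refine IsCoprime.pow ?_
    rw [Int.isCoprime_iff_nat_coprime, Int.natAbs_natCast]
    exact q.reduced.symm
  have h5 : (q.den : ℤ) * q.den ∣ d := by
    rw [← sq]
    exact h4.dvd_of_dvd_mul_right (Dvd.intro_left k h1.symm)
  have h6 := Int.isUnit_iff_natAbs_eq.1 (hd _ h5)
  exact ⟨q.num, (Rat.coe_int_num_of_den_eq_one h6).symm⟩

theorem eq_zero_of_add_smul_eq_zero {d : ℤ} {s : K} (hs : s * s = d)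
    (hd : ¬ IsSquare (d : ℚ)) (u v : ℚ) (h : u • (1 : K) + v • s = 0) : u = 0 ∧ v = 0 := by
  rw [Algebra.smul_def, Algebra.smul_def, eq_ratCast, eq_ratCast, mul_one] at h
  have hv : v = 0 := by
    by_contra hv
    refine hd ⟨u / v, ?_⟩
    have hv' : (v : K) ≠ 0 := by exact_mod_cast hv
    have : (d : K) = ((u / v * (u / v) : ℚ) : K) := by
      push_cast
      field_simp
      linear_combination (-(v : K) ^ 2) * hs - ((u : K) - v * s) * h
    exact_mod_cast this
  subst hv
  simpa using h

theorem exists_int_of_isIntegral_s8 {d : ℤ} {s : K} (hs : s * s = d)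
    (hsp : ∀ x : K, ∃ u v : ℚ, x = u • 1 + v • s)
    (hd : Squarefree d) (hd' : ¬ IsSquare (d : ℚ)) {x : K} (hx : IsIntegral ℤ x) :
    ∃ a b : ℤ, 2 * x = a + b * s ∧ 4 ∣ a ^ 2 - d * b ^ 2 := by
  obtain ⟨B, h0, h1⟩ := exists_basis_fin_two s hsp (eq_zero_of_add_smul_eq_zero hs hd')
  have hB : B 1 * B 1 = (d : ℚ) • B 0 + (0 : ℚ) • B 1 := by
    rw [h0, h1, hs, zero_smul, add_zero, Algebra.smul_def, mul_one, map_intCast]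
  obtain ⟨u, v, huv⟩ := hsp x
  have ht := trace_of_mul_self B h0 hB u v
  have hn := norm_of_mul_self B h0 hB u v
  rw [h0, h1, ← huv] at ht hn
  obtain ⟨a, ha⟩ := IsIntegrallyClosed.isIntegral_iff.1
    (Algebra.isIntegral_trace (L := ℚ) hx)
  obtain ⟨m, hm⟩ := IsIntegrallyClosed.isIntegral_iff.1
    (Algebra.isIntegral_norm ℚ hx)
  rw [ht, eq_intCast] at ha
  rw [hn, eq_intCast] at hm
  have hk : d * (2 * v) ^ 2 = ((a ^ 2 - 4 * m : ℤ) : ℚ) := by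
    push_cast
    rw [ha, hm]
    ring
  obtain ⟨b, hb⟩ := exists_int_of_squarefree_mul_sq hd hk
  refine ⟨a, b, ?_, m, ?_⟩
  · have ha' : (a : K) = 2 * (u : K) := by
      have := congrArg (Rat.cast (K := K)) ha
      push_cast at this
      rw [this]
      ring
    have hb' : (b : K) = 2 * (v : K) := by
      have := congrArg (Rat.cast (K := K)) hb
      push_cast at this
      exact this.symm
    rw [huv, ha', hb', Algebra.smul_def, Algebra.smul_def, eq_ratCast, eq_ratCast]
    ring
  · rw [hb] at hk
    have : d * b ^ 2 = a ^ 2 - 4 * m := by exact_mod_cast hk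
    rw [this]
    ring

end

theorem nonempty_mulEquiv_of_sq_eq_one {G : Type*} [Group G] (c : G) (h1 : c ≠ 1) (h2 : c ^ 2 = 1)
    (h : ∀ x, x ∈ Subgroup.zpowers c) : Nonempty (G ≃* Multiplicative (ZMod 2)) := by
  have h3 : Nat.card G = 2 := by
    rw [← orderOf_eq_card_of_forall_mem_zpowers h]
    exact orderOf_eq_prime h2 h1
  exact ⟨mulEquivOfPrimeCardEq (p := 2) h3 (by simp)⟩

section
variable {R : Type*} [CommRing R]

theorem span_pair_mul_span_pair_eq_span_singleton {a b c d g : R} (h1 : g ∣ a * c)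
    (h2 : g ∣ a * d) (h3 : g ∣ b * c) (h4 : g ∣ b * d) {x y z w : R}
    (h : g = x * (a * c) + y * (a * d) + z * (b * c) + w * (b * d)) :
    Ideal.span {a, b} * Ideal.span {c, d} = Ideal.span {g} := by
  rw [Ideal.span_pair_mul_span_pair]
  apply le_antisymm
  · rw [Ideal.span_le]
    rintro e (rfl | rfl | rfl | rfl) <;> rw [SetLike.mem_coe, Ideal.mem_span_singleton] <;>
      assumption
  · rw [Ideal.span_singleton_le_iff_mem, h]
    refine add_mem (add_mem (add_mem ?_ ?_) ?_) ?_ <;>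
      exact Ideal.mul_mem_left _ _ (Ideal.subset_span (by simp))

theorem not_isCoprime_of_intCast_mem {P : Ideal R} (hP : P ≠ ⊤) {m n : ℤ} (hm : (m : R) ∈ P)
    (hn : (n : R) ∈ P) : ¬ IsCoprime m n := by
  rintro ⟨x, y, h⟩
  refine hP ((Ideal.eq_top_iff_one P).2 ?_)
  have : (1 : R) = x * m + y * n := by exact_mod_cast congrArg (Int.cast (R := R)) h.symm
  rw [this]
  exact add_mem (Ideal.mul_mem_left _ _ hm) (Ideal.mul_mem_left _ _ hn)

theorem eq_span_pair_of_mem {ω : R} (hsp : ∀ x : R, ∃ a b : ℤ, x = a + b * ω) {P : Ideal R}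
    (hP : P ≠ ⊤) {p r : ℤ} (hp : Prime p) {q δ : R} (hq : q = p) (hδ : δ = ω - r) (hqP : q ∈ P)
    (hδP : δ ∈ P) : P = Ideal.span {q, δ} := by
  apply le_antisymm
  · intro x hx
    obtain ⟨a, b, rfl⟩ := hsp x
    have h1 : ((a + b * r : ℤ) : R) ∈ P := by
      have : ((a + b * r : ℤ) : R) = (a + b * ω) - b * δ := by
        rw [hδ]
        push_cast
        ring
      rw [this]
      exact sub_mem hx (Ideal.mul_mem_left _ _ hδP)
    rw [hq] at hqP
    have h2 : p ∣ a + b * r := by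
      by_contra h
      exact not_isCoprime_of_intCast_mem hP hqP h1 ((Prime.coprime_iff_not_dvd hp).2 h)
    obtain ⟨k, hk⟩ := h2
    refine Ideal.mem_span_pair.2 ⟨k, b, ?_⟩
    have : (a + b * r : R) = p * k := by exact_mod_cast congrArg (Int.cast (R := R)) hk
    rw [hq, hδ]
    linear_combination -this
  · rw [Ideal.span_le]
    rintro e (rfl | rfl) <;> assumption

/-- In a quadratic ring `ℤ[ω]`, an ideal `(3, ω - r)` over a prime `3` exactly dividing the norm of
`ω - r` is not principal if the norm form does not represent `±3`. -/
theorem not_isPrincipal_span_three {ω : R} {t n r : ℤ}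
    (hsp : ∀ x : R, ∃ a b : ℤ, x = a + b * ω)
    (hun : ∀ a b : ℤ, (a : R) + b * ω = 0 → a = 0 ∧ b = 0)
    (hω : ω * ω = n + t * ω) (hr : 3 ∣ r ^ 2 - t * r - n) (hr' : ¬ 9 ∣ r ^ 2 - t * r - n)
    (hN : ∀ a b : ℤ, |a ^ 2 + t * a * b - n * b ^ 2| ≠ 3) :
    ¬ (Ideal.span {(3 : R), ω - r}).IsPrincipal := by
  rintro ⟨g, hg⟩
  obtain ⟨B, h0, h1⟩ := exists_basis_fin_two (R := ℤ) ω
    (fun x ↦ by simpa [zsmul_eq_mul] using hsp x) (fun u v h ↦ hun u v (by simpa using h))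
  have hB : B 1 * B 1 = n • B 0 + t • B 1 := by simp [h0, h1, hω]
  have norm_eq (a b : ℤ) : Algebra.norm ℤ ((a : R) + b * ω) = a ^ 2 + t * a * b - n * b ^ 2 := by
    simpa [h0, h1] using norm_of_mul_self B h0 hB a b
  replace hg : Ideal.span {(3 : R), ω - r} = Ideal.span {g} := hg
  have g3 : g ∣ 3 := by
    rw [← Ideal.mem_span_singleton, ← hg]
    exact Ideal.subset_span (by simp)
  have gω : g ∣ ω - r := by
    rw [← Ideal.mem_span_singleton, ← hg]
    exact Ideal.subset_span (by simp)
  have n3 : Algebra.norm ℤ g ∣ 9 := by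
    have := map_dvd (Algebra.norm ℤ) g3
    have h := norm_eq 3 0
    norm_num at h
    rwa [h] at this
  have nω : Algebra.norm ℤ g ∣ r ^ 2 - t * r - n := by
    have := map_dvd (Algebra.norm ℤ) gω
    have h := norm_eq (-r) 1
    rw [show (((-r : ℤ) : R) + (1 : ℤ) * ω) = ω - r by push_cast; ring] at h
    rw [h] at this
    have e : (-r) ^ 2 + t * -r * 1 - n * 1 ^ 2 = r ^ 2 - t * r - n := by ring
    rwa [e] at this
  obtain ⟨a, b, rfl⟩ := hsp g
  have hab := hN a b
  rw [norm_eq] at n3 nω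
  have hunit : |a ^ 2 + t * a * b - n * b ^ 2| = 1 := by
    rw [← abs_dvd] at n3 nω
    have hnn := abs_nonneg (a ^ 2 + t * a * b - n * b ^ 2)
    generalize |a ^ 2 + t * a * b - n * b ^ 2| = m at *
    generalize r ^ 2 - t * r - n = f at *
    have hm := Int.le_of_dvd (by norm_num) n3
    interval_cases m <;> omega
  have hone : (1 : R) ∈ Ideal.span {(3 : R), ω - r} := by
    rw [hg, Ideal.mem_span_singleton]
    have hd : (a + b * ω : R) ∣ ((a ^ 2 + t * a * b - n * b ^ 2 : ℤ) : R) :=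
      ⟨a + t * b - b * ω, by push_cast; linear_combination (b : R) ^ 2 * hω⟩
    refine hd.trans ((Int.isUnit_iff_abs_eq.2 hunit).map (Int.castRingHom R)).dvd
  obtain ⟨x, y, hxy⟩ := Ideal.mem_span_pair.1 hone
  obtain ⟨x0, x1, rfl⟩ := hsp x
  obtain ⟨c, d, rfl⟩ := hsp y
  obtain ⟨e0, e1⟩ := hun (3 * x0 + d * n - r * c - 1) (3 * x1 + c + d * t - r * d) (by
    push_cast
    linear_combination hxy - (d : R) * hω)
  obtain ⟨k, hk⟩ := hr
  have : 3 * (x0 + r * x1 - d * k) = 1 := by linear_combination e0 + r * e1 + d * hk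
  omega
end

section
variable {K : Type*} [Field K] [NumberField K]

open NumberField.InfinitePlace nonZeroDivisors

/-- If every class contains an ideal of norm at most `B`, then a subgroup containing the classes of
the primes of norm at most `B` is everything. -/
theorem mem_of_forall_isPrime {H : Subgroup (ClassGroup (𝓞 K))} {B : ℕ}
    (hB : ∀ C : ClassGroup (𝓞 K), ∃ I : (Ideal (𝓞 K))⁰, ClassGroup.mk0 I = C ∧
      Ideal.absNorm (I : Ideal (𝓞 K)) ≤ B)
    (hP : ∀ P : (Ideal (𝓞 K))⁰, (P : Ideal (𝓞 K)).IsPrime →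
      Ideal.absNorm (P : Ideal (𝓞 K)) ≤ B → ClassGroup.mk0 P ∈ H) (C : ClassGroup (𝓞 K)) :
    C ∈ H := by
  obtain ⟨⟨I, hI⟩, rfl, hIB⟩ := hB C
  induction I using UniqueFactorizationMonoid.induction_on_prime with
  | h₁ => exact absurd rfl (mem_nonZeroDivisors_iff_ne_zero.1 hI)
  | h₂ I hu =>
    have : ClassGroup.mk0 ⟨I, hI⟩ = 1 := by
      rw [ClassGroup.mk0_eq_one_iff, Ideal.isUnit_iff.1 hu]
      exact top_isPrincipal
    rw [this]
    exact one_mem H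
  | h₃ I P hI0 hPp ih =>
    have hI' : I ∈ (Ideal (𝓞 K))⁰ := mem_nonZeroDivisors_of_ne_zero hI0
    have hP' : P ∈ (Ideal (𝓞 K))⁰ := mem_nonZeroDivisors_of_ne_zero hPp.ne_zero
    have hmul : ClassGroup.mk0 ⟨P * I, hI⟩ = ClassGroup.mk0 ⟨P, hP'⟩ * ClassGroup.mk0 ⟨I, hI'⟩ := by
      rw [← map_mul]
      rfl
    have h1 : Ideal.absNorm P ≠ 0 := Ideal.absNorm_eq_zero_iff.not.2 hPp.ne_zero
    have h2 : Ideal.absNorm I ≠ 0 := Ideal.absNorm_eq_zero_iff.not.2 hI0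
    simp only [map_mul] at hIB
    rw [hmul]
    refine mul_mem (hP _ (Ideal.isPrime_of_prime hPp) ?_) (ih hI' ?_)
    · exact (Nat.le_mul_of_pos_right _ (Nat.pos_of_ne_zero h2)).trans hIB
    · exact (Nat.le_mul_of_pos_left _ (Nat.pos_of_ne_zero h1)).trans hIB

theorem exists_prime_natCast_mem {P : Ideal (𝓞 K)} (hP : P.IsPrime) (h0 : P ≠ ⊥) {B : ℕ}
    (hB : Ideal.absNorm P ≤ B) : ∃ p : ℕ, p.Prime ∧ p ≤ B ∧ (p : 𝓞 K) ∈ P := by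
  have hn : Ideal.absNorm P ≠ 0 := Ideal.absNorm_eq_zero_iff.not.2 h0
  have hmem := Ideal.absNorm_mem P
  rw [← Nat.prod_primeFactorsList hn, Nat.cast_list_prod, ← Multiset.prod_coe,
    hP.multiset_prod_mem_iff_exists_mem] at hmem
  obtain ⟨x, hx, hxP⟩ := hmem
  obtain ⟨p, hp, rfl⟩ := List.mem_map.1 (Multiset.mem_coe.1 hx)
  exact ⟨p, Nat.prime_of_mem_primeFactorsList hp,
    (Nat.le_of_mem_primeFactorsList hp).trans hB, hxP⟩

theorem finrank_and_discr_of_mul_self {ω : 𝓞 K} {t n : ℤ}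
    (hsp : ∀ x : 𝓞 K, ∃ a b : ℤ, x = a + b * ω)
    (hun : ∀ a b : ℤ, (a : 𝓞 K) + b * ω = 0 → a = 0 ∧ b = 0)
    (hω : ω * ω = n + t * ω) : Module.finrank ℚ K = 2 ∧ discr K = t ^ 2 + 4 * n := by
  obtain ⟨B, h0, h1⟩ := exists_basis_fin_two (R := ℤ) ω
    (fun x ↦ by simpa [zsmul_eq_mul] using hsp x) (fun u v h ↦ hun u v (by simpa using h))
  have hB : B 1 * B 1 = n • B 0 + t • B 1 := by simp [h0, h1, hω]
  refine ⟨?_, ?_⟩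
  · rw [← RingOfIntegers.rank, Module.finrank_eq_card_basis B, Fintype.card_fin]
  · rw [← discr_eq_discr K B, discr_of_mul_self B h0 hB]

theorem mk0_mem_of_eq_span_singleton {H : Subgroup (ClassGroup (𝓞 K))} {P : (Ideal (𝓞 K))⁰} {g : 𝓞 K}
    (h : (P : Ideal (𝓞 K)) = Ideal.span {g}) : ClassGroup.mk0 P ∈ H := by
  have : ClassGroup.mk0 P = 1 := (ClassGroup.mk0_eq_one_iff P.2).2 ⟨g, h⟩
  rw [this]
  exact one_mem H

theorem mk0_mem_of_mul_eq {H : Subgroup (ClassGroup (𝓞 K))} {P Q : (Ideal (𝓞 K))⁰} {g : 𝓞 K}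
    (h : (P * Q : Ideal (𝓞 K)) = Ideal.span {g}) (hQ : ClassGroup.mk0 Q ∈ H) :
    ClassGroup.mk0 P ∈ H := by
  have h1 : ClassGroup.mk0 (P * Q) = 1 := (ClassGroup.mk0_eq_one_iff (P * Q).2).2 ⟨g, h⟩
  rw [map_mul] at h1
  rw [eq_inv_of_mul_eq_one_left h1]
  exact inv_mem hQ

theorem span_three_mem_nonZeroDivisors (x : 𝓞 K) :
    Ideal.span {(3 : 𝓞 K), x} ∈ (Ideal (𝓞 K))⁰ := by
  refine mem_nonZeroDivisors_of_ne_zero fun h ↦ ?_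
  have : (3 : 𝓞 K) ∈ Ideal.span {(3 : 𝓞 K), x} := Ideal.subset_span (by simp)
  rw [h] at this
  exact OfNat.ofNat_ne_zero 3 (Ideal.mem_bot.1 this)

theorem nonempty_classGroup_mulEquiv_of_mul_self_eq_fiftyOne {s : 𝓞 K}
    (hsp : ∀ x : 𝓞 K, ∃ a b : ℤ, x = a + b * s)
    (hun : ∀ a b : ℤ, (a : 𝓞 K) + b * s = 0 → a = 0 ∧ b = 0)
    (hs : s * s = 51) (hr : 0 < nrRealPlaces K) :
    Nonempty (ClassGroup (𝓞 K) ≃* Multiplicative (ZMod 2)) := by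
  have hs' : s * s = ((51 : ℤ) : 𝓞 K) + (0 : ℤ) * s := by rw [hs]; push_cast; ring
  obtain ⟨hrank, hdiscr⟩ := finrank_and_discr_of_mul_self hsp hun hs'
  set Q : (Ideal (𝓞 K))⁰ := ⟨_, span_three_mem_nonZeroDivisors s⟩
  have hQv : (Q : Ideal (𝓞 K)) = Ideal.span {3, s} := rfl
  have hQ2 : (Q * Q : Ideal (𝓞 K)) = Ideal.span {3} := by
    refine span_pair_mul_span_pair_eq_span_singleton (x := 6) (y := 0) (z := 0) (w := -1)
      ⟨3, by ring⟩ ⟨s, by ring⟩ ⟨s, by ring⟩ ⟨17, by rw [hs]; norm_num⟩ ?_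
    rw [hs]; norm_num
  refine nonempty_mulEquiv_of_sq_eq_one (ClassGroup.mk0 Q) ?_ ?_ ?_
  · rw [Ne, ClassGroup.mk0_eq_one_iff Q.2]
    have := not_isPrincipal_span_three (r := 0) hsp hun hs' (by norm_num) (by norm_num) ?_
    · simpa using this
    · intro a b h
      rcases abs_eq (by norm_num) |>.1 h with h | h
      all_goals
        replace h := congrArg (Int.cast (R := ZMod 17)) h
        push_cast at h
        rw [show (51 : ZMod 17) = 0 from rfl, zero_mul, zero_mul, zero_mul, add_zero,
          sub_zero] at h
        generalize (a : ZMod 17) = z at h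
        revert z
        decide
  · rw [sq, ← map_mul]
    exact (ClassGroup.mk0_eq_one_iff (Q * Q).2).2 ⟨3, hQ2⟩
  · refine mem_of_forall_isPrime (B := 7) (fun C ↦ ?_) ?_
    · obtain ⟨I, hI, hIn⟩ := exists_ideal_in_class_of_norm_le C
      refine ⟨I, hI, ?_⟩
      have hr' : nrComplexPlaces K = 0 := by
        have := card_add_two_mul_card_eq_rank K
        omega
      rw [hr', hrank, hdiscr] at hIn
      have : √204 < 16 := by
        rw [Real.sqrt_lt' (by norm_num)]
        norm_num
      norm_num [Nat.factorial] at hIn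
      have h8 : (Ideal.absNorm (I : Ideal (𝓞 K)) : ℝ) < 8 := by linarith
      have : Ideal.absNorm (I : Ideal (𝓞 K)) < 8 := by exact_mod_cast h8
      omega
    · intro P hP hPB
      have hPt := hP.ne_top
      have hQm := Subgroup.mem_zpowers (ClassGroup.mk0 Q)
      obtain ⟨p, hp, hp7, hpP⟩ := exists_prime_natCast_mem hP (nonZeroDivisors.coe_ne_zero P) hPB
      have hpc : p = 2 ∨ p = 3 ∨ p = 5 ∨ p = 7 := by
        interval_cases p <;> revert hp <;> norm_num
      rcases hpc with rfl | rfl | rfl | rfl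
      · push_cast at hpP
        have h1 : s - 1 ∈ (P : Ideal (𝓞 K)) := by
          refine (hP.mem_or_mem (?_ : (s - 1) * (s - 1) ∈ _)).elim id id
          rw [show (s - 1) * (s - 1) = (26 - s) * 2 by linear_combination hs]
          exact Ideal.mul_mem_left _ _ hpP
        have h2 := eq_span_pair_of_mem hsp hPt Int.prime_two (r := 1) (by norm_num) (by simp)
          hpP h1
        refine mk0_mem_of_eq_span_singleton (g := 7 + s) (h2.trans (le_antisymm ?_ ?_))
        · rw [Ideal.span_le]
          rintro e (rfl | rfl) <;> rw [SetLike.mem_coe, Ideal.mem_span_singleton]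
          · exact ⟨s - 7, by linear_combination -hs⟩
          · exact ⟨1 - 4 * (s - 7), by linear_combination 4 * hs⟩
        · rw [Ideal.span_singleton_le_iff_mem, Ideal.mem_span_pair]
          exact ⟨4, 1, by ring⟩
      · push_cast at hpP
        have h1 : s ∈ (P : Ideal (𝓞 K)) := by
          refine (hP.mem_or_mem (?_ : s * s ∈ _)).elim id id
          rw [show s * s = 17 * 3 by linear_combination hs]
          exact Ideal.mul_mem_left _ _ hpP
        have h2 := eq_span_pair_of_mem hsp hPt Int.prime_three (r := 0) (by norm_num) (by simp)
          hpP h1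
        rwa [show P = Q from Subtype.ext h2]
      · push_cast at hpP
        have h1 : (s - 1) * (s + 1) ∈ (P : Ideal (𝓞 K)) := by
          rw [show (s - 1) * (s + 1) = 10 * 5 by linear_combination hs]
          exact Ideal.mul_mem_left _ _ hpP
        have hp5 : Prime (5 : ℤ) := by norm_num
        rcases hP.mem_or_mem h1 with h1 | h1
        · have h2 := eq_span_pair_of_mem hsp hPt hp5 (r := 1) (by norm_num) (by simp) hpP h1
          refine mk0_mem_of_mul_eq (g := s - 6) ?_ hQm
          rw [h2, hQv]
          exact span_pair_mul_span_pair_eq_span_singleton (x := 3) (y := 0) (z := 0) (w := -1)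
            ⟨s + 6, by linear_combination -hs⟩ ⟨17 + 2 * s, by linear_combination -2 * hs⟩
            ⟨9 + s, by linear_combination -hs⟩ ⟨17 + 3 * s, by linear_combination -2 * hs⟩
            (by linear_combination hs)
        · have h2 := eq_span_pair_of_mem hsp hPt hp5 (r := -1) (by norm_num) (by simp) hpP h1
          refine mk0_mem_of_mul_eq (g := s + 6) ?_ hQm
          rw [h2, hQv]
          exact span_pair_mul_span_pair_eq_span_singleton (x := -3) (y := 0) (z := 0) (w := 1)
            ⟨s - 6, by linear_combination -hs⟩ ⟨17 - 2 * s, by linear_combination 2 * hs⟩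
            ⟨9 - s, by linear_combination hs⟩ ⟨3 * s - 17, by linear_combination -2 * hs⟩
            (by linear_combination -hs)
      · push_cast at hpP
        have h1 : (s - 3) * (s + 3) ∈ (P : Ideal (𝓞 K)) := by
          rw [show (s - 3) * (s + 3) = 6 * 7 by linear_combination hs]
          exact Ideal.mul_mem_left _ _ hpP
        have hp7 : Prime (7 : ℤ) := by norm_num
        rcases hP.mem_or_mem h1 with h1 | h1
        · have h2 := eq_span_pair_of_mem hsp hPt hp7 (r := 3) (by norm_num) (by simp) hpP h1
          refine mk0_mem_of_mul_eq (g := 15 + 2 * s) ?_ hQm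
          rw [h2, hQv]
          exact span_pair_mul_span_pair_eq_span_singleton (x := -1) (y := 2) (z := -4) (w := 0)
            ⟨15 - 2 * s, by linear_combination 4 * hs⟩
            ⟨5 * s - 34, by linear_combination -10 * hs⟩
            ⟨3 * s - 21, by linear_combination -6 * hs⟩
            ⟨51 - 7 * s, by linear_combination 15 * hs⟩ (by ring)
        · have h2 := eq_span_pair_of_mem hsp hPt hp7 (r := -3) (by norm_num) (by simp) hpP h1
          refine mk0_mem_of_mul_eq (g := 15 - 2 * s) ?_ hQm
          rw [h2, hQv]
          exact span_pair_mul_span_pair_eq_span_singleton (x := -1) (y := -2) (z := 4) (w := 0)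
            ⟨15 + 2 * s, by linear_combination 4 * hs⟩
            ⟨5 * s + 34, by linear_combination 10 * hs⟩
            ⟨3 * s + 21, by linear_combination 6 * hs⟩
            ⟨51 + 7 * s, by linear_combination 15 * hs⟩ (by ring)

theorem nonempty_classGroup_mulEquiv_of_mul_self_eq_sub {ω : 𝓞 K}
    (hsp : ∀ x : 𝓞 K, ∃ a b : ℤ, x = a + b * ω)
    (hun : ∀ a b : ℤ, (a : 𝓞 K) + b * ω = 0 → a = 0 ∧ b = 0)
    (hω : ω * ω = ω - 13) :
    Nonempty (ClassGroup (𝓞 K) ≃* Multiplicative (ZMod 2)) := by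
  have hω' : ω * ω = ((-13 : ℤ) : 𝓞 K) + (1 : ℤ) * ω := by rw [hω]; push_cast; ring
  obtain ⟨hrank, hdiscr⟩ := finrank_and_discr_of_mul_self hsp hun hω'
  set Q : (Ideal (𝓞 K))⁰ := ⟨_, span_three_mem_nonZeroDivisors (ω + 1)⟩
  have hQ2 : (Q * Q : Ideal (𝓞 K)) = Ideal.span {3} := by
    refine span_pair_mul_span_pair_eq_span_singleton (x := 2) (y := -1) (z := 0) (w := 1)
      ⟨3, by ring⟩ ⟨ω + 1, by ring⟩ ⟨ω + 1, by ring⟩ ⟨ω - 4, by linear_combination hω⟩ ?_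
    linear_combination -hω
  refine nonempty_mulEquiv_of_sq_eq_one (ClassGroup.mk0 Q) ?_ ?_ ?_
  · rw [Ne, ClassGroup.mk0_eq_one_iff Q.2]
    have := not_isPrincipal_span_three (r := -1) hsp hun hω' (by norm_num) (by norm_num) ?_
    · simpa using this
    · intro a b h
      have h1 : a ^ 2 + 1 * a * b - -13 * b ^ 2 ≤ 3 := (le_abs_self _).trans h.le
      have hb : b = 0 := by
        by_contra hb
        have : 0 < b ^ 2 := by positivity
        nlinarith [sq_nonneg (2 * a + b)]
      subst hb
      have h2 : a ^ 2 = 3 := by simpa using h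
      have h3 : a < 2 := by nlinarith
      have h4 : -2 < a := by nlinarith
      interval_cases a <;> omega
  · rw [sq, ← map_mul]
    exact (ClassGroup.mk0_eq_one_iff (Q * Q).2).2 ⟨3, hQ2⟩
  · refine mem_of_forall_isPrime (B := 4) (fun C ↦ ?_) ?_
    · obtain ⟨I, hI, hIn⟩ := exists_ideal_in_class_of_norm_le C
      refine ⟨I, hI, ?_⟩
      have hr : nrComplexPlaces K ≤ 1 := by
        have := card_add_two_mul_card_eq_rank K
        omega
      rw [hrank, hdiscr] at hIn
      have h1 : √51 < 7.142 := by
        rw [Real.sqrt_lt' (by norm_num)]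
        norm_num
      have hpi := Real.pi_gt_d2
      have h2 : (4 / Real.pi) ^ nrComplexPlaces K ≤ 4 / 3.14 := by
        have h3 : 1 ≤ 4 / Real.pi := by
          rw [one_le_div Real.pi_pos]
          exact Real.pi_le_four
        calc _ ≤ (4 / Real.pi) ^ 1 := pow_le_pow_right₀ h3 hr
          _ ≤ _ := by rw [pow_one]; gcongr
      norm_num [Nat.factorial] at hIn
      have h8 : (Ideal.absNorm (I : Ideal (𝓞 K)) : ℝ) < 5 := by
        calc _ ≤ (4 / Real.pi) ^ nrComplexPlaces K * (1 / 2 * √51) := hIn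
          _ ≤ 4 / 3.14 * (1 / 2 * 7.142) := by gcongr
          _ < 5 := by norm_num
      have : Ideal.absNorm (I : Ideal (𝓞 K)) < 5 := by exact_mod_cast h8
      omega
    · intro P hP hPB
      have hPt := hP.ne_top
      obtain ⟨p, hp, hp4, hpP⟩ := exists_prime_natCast_mem hP (nonZeroDivisors.coe_ne_zero P) hPB
      have hpc : p = 2 ∨ p = 3 := by
        interval_cases p <;> revert hp <;> norm_num
      rcases hpc with rfl | rfl
      · push_cast at hpP
        refine mk0_mem_of_eq_span_singleton (g := 2) (le_antisymm (fun x hx ↦ ?_) ?_)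
        · obtain ⟨a, b, rfl⟩ := hsp x
          have hpP' : ((2 : ℤ) : 𝓞 K) ∈ (P : Ideal (𝓞 K)) := by exact_mod_cast hpP
          have hNm : ((a ^ 2 + a * b + 13 * b ^ 2 : ℤ) : 𝓞 K) ∈ (P : Ideal (𝓞 K)) := by
            have : ((a ^ 2 + a * b + 13 * b ^ 2 : ℤ) : 𝓞 K) = (a + b - b * ω) * (a + b * ω) := by
              push_cast
              linear_combination (b : 𝓞 K) ^ 2 * hω
            rw [this]
            exact Ideal.mul_mem_left _ _ hx
          have h2 : 2 ∣ a ^ 2 + a * b + 13 * b ^ 2 := by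
            by_contra h
            exact not_isCoprime_of_intCast_mem hPt hpP' hNm ((Prime.coprime_iff_not_dvd Int.prime_two).2 h)
          have h3 : 2 ∣ a ∧ 2 ∣ b := by
            simp only [← even_iff_two_dvd] at h2 ⊢
            revert h2
            simp only [Int.even_add, Int.even_mul, Int.even_pow]
            have : ¬ Even (13 : ℤ) := by decide
            tauto
          obtain ⟨⟨c, rfl⟩, d, rfl⟩ := h3
          exact Ideal.mem_span_singleton.2 ⟨c + d * ω, by push_cast; ring⟩
        · exact (Ideal.span_singleton_le_iff_mem _).2 hpP
      · push_cast at hpP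
        have h1 : ω + 1 ∈ (P : Ideal (𝓞 K)) := by
          refine (hP.mem_or_mem (?_ : (ω + 1) * (ω + 1) ∈ _)).elim id id
          rw [show (ω + 1) * (ω + 1) = (ω - 4) * 3 by linear_combination hω]
          exact Ideal.mul_mem_left _ _ hpP
        have h2 := eq_span_pair_of_mem hsp hPt Int.prime_three (r := -1) (by norm_num) (by simp)
          hpP h1
        rw [show P = Q from Subtype.ext h2]
        exact Subgroup.mem_zpowers _

theorem intCast_eq_zero_of_add_mul_eq_zero {d : ℤ} {s : K} (hs : s * s = d)
    (hd : ¬ IsSquare (d : ℚ)) (a b : ℤ) (h : (a : K) + b * s = 0) : a = 0 ∧ b = 0 := by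
  simpa using eq_zero_of_add_smul_eq_zero hs hd a b (by simpa [Algebra.smul_def] using h)

theorem squarefree_fiftyOne : Squarefree (51 : ℕ) :=
  (Nat.squarefree_mul (m := 3) (n := 17) (by norm_num)).2
    ⟨Nat.prime_three.squarefree, (by norm_num : Nat.Prime 17).squarefree⟩

theorem not_isSquare_intCast_of_squarefree {d : ℤ} (hd : Squarefree d) (h1 : d ≠ 1) :
    ¬ IsSquare (d : ℚ) := by
  rw [Rat.isSquare_intCast_iff]
  rintro ⟨k, rfl⟩
  rcases Int.isUnit_iff.1 (hd k dvd_rfl) with rfl | rfl <;> simp at h1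

theorem nonempty_classGroup_mulEquiv_of_sqrt_fiftyOne {s : K} (hs : s * s = 51)
    (hsp : ∀ x : K, ∃ u v : ℚ, x = u • 1 + v • s) (hr : 0 < nrRealPlaces K) :
    Nonempty (ClassGroup (𝓞 K) ≃* Multiplicative (ZMod 2)) := by
  have hs' : s * s = (51 : ℤ) := by exact_mod_cast hs
  have hsf : Squarefree (51 : ℤ) := Int.squarefree_natAbs.1 squarefree_fiftyOne
  have hd := not_isSquare_intCast_of_squarefree hsf (by norm_num)
  have hint : IsIntegral ℤ s := ⟨X ^ 2 - C 51, by monicity!, by simp [sq, hs]⟩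
  obtain ⟨σ, rfl⟩ : ∃ σ : 𝓞 K, algebraMap (𝓞 K) K σ = s := ⟨⟨s, hint⟩, rfl⟩
  refine nonempty_classGroup_mulEquiv_of_mul_self_eq_fiftyOne (s := σ) (fun x ↦ ?_)
    (fun a b h ↦ ?_) (FaithfulSMul.algebraMap_injective (𝓞 K) K (by rw [map_mul, hs, map_ofNat])) hr
  · obtain ⟨a, b, hab, h4⟩ := exists_int_of_isIntegral_s8 hs' hsp hsf hd x.isIntegral_coe
    have hev : Even a ∧ Even b := by
      obtain ⟨k, hk⟩ := h4
      rcases Int.even_or_odd' a with ⟨c, rfl | rfl⟩ <;>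
        rcases Int.even_or_odd' b with ⟨e, rfl | rfl⟩ <;> ring_nf at hk
      · simp
      all_goals omega
    simp only [even_iff_two_dvd] at hev
    obtain ⟨⟨a, rfl⟩, b, rfl⟩ := hev
    refine ⟨a, b, RingOfIntegers.ext ?_⟩
    push_cast at hab
    simp only [map_add, map_mul, map_intCast]
    have h2 : (2 : K) ≠ 0 := two_ne_zero
    apply mul_left_cancel₀ h2
    linear_combination hab
  · exact intCast_eq_zero_of_add_mul_eq_zero hs' hd a b
      (by simpa using congrArg (algebraMap (𝓞 K) K) h)

theorem nonempty_classGroup_mulEquiv_of_sqrt_neg_fiftyOne {s : K} (hs : s * s = -51)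
    (hsp : ∀ x : K, ∃ u v : ℚ, x = u • 1 + v • s) :
    Nonempty (ClassGroup (𝓞 K) ≃* Multiplicative (ZMod 2)) := by
  have hs' : s * s = (-51 : ℤ) := by rw [hs]; push_cast; rfl
  have hsf : Squarefree (-51 : ℤ) := Int.squarefree_natAbs.1 squarefree_fiftyOne
  have hd := not_isSquare_intCast_of_squarefree hsf (by norm_num)
  have hω : (1 + s) / 2 * ((1 + s) / 2) = (1 + s) / 2 - 13 := by linear_combination hs / 4
  have hint : IsIntegral ℤ ((1 + s) / 2) :=
    ⟨X ^ 2 - X + C 13, by monicity!, by simp [sq, hω]⟩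
  obtain ⟨w, hw⟩ : ∃ w : 𝓞 K, algebraMap (𝓞 K) K w = (1 + s) / 2 := ⟨⟨_, hint⟩, rfl⟩
  refine nonempty_classGroup_mulEquiv_of_mul_self_eq_sub (ω := w) (fun x ↦ ?_)
    (fun a b h ↦ ?_) (FaithfulSMul.algebraMap_injective (𝓞 K) K ?_)
  · obtain ⟨a, b, hab, h4⟩ := exists_int_of_isIntegral_s8 hs' hsp hsf hd x.isIntegral_coe
    have hev : 2 ∣ a - b := by
      obtain ⟨k, hk⟩ := h4
      rcases Int.even_or_odd' a with ⟨c, rfl | rfl⟩ <;>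
        rcases Int.even_or_odd' b with ⟨e, rfl | rfl⟩ <;> ring_nf at hk <;> omega
    obtain ⟨c, hc⟩ := hev
    obtain rfl : a = 2 * c + b := by omega
    refine ⟨c, b, RingOfIntegers.ext ?_⟩
    push_cast at hab
    simp only [map_add, map_mul, map_intCast, hw]
    linear_combination hab / 2
  · have h' : (a : K) + b * ((1 + s) / 2) = 0 := by
      simpa [hw] using congrArg (algebraMap (𝓞 K) K) h
    have := intCast_eq_zero_of_add_mul_eq_zero hs' hd (2 * a + b) b
      (by push_cast; linear_combination 2 * h')
    omega
  · rw [map_mul, map_sub, hw, hω, map_ofNat]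

end

theorem exists_eq_smul_one_add_smul_gen {E : Type*} [Field E] [Algebra ℚ E] {α : E} {d : ℚ}
    (hα : α * α = algebraMap ℚ E d) (x : ℚ⟮α⟯) :
    ∃ u v : ℚ, x = u • 1 + v • AdjoinSimple.gen ℚ α := by
  have hint : IsIntegral ℚ α := ⟨X ^ 2 - C d, by monicity!, by simp [sq, hα]⟩
  obtain ⟨x, hx'⟩ := x
  suffices h : ∃ u v : ℚ, x = algebraMap ℚ E u + algebraMap ℚ E v * α by
    obtain ⟨u, v, h⟩ := h
    exact ⟨u, v, Subtype.ext (by simp [h, Algebra.smul_def])⟩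
  have hx : x ∈ Algebra.adjoin ℚ {α} := by
    rw [← adjoin_simple_toSubalgebra_of_isAlgebraic hint.isAlgebraic]
    exact hx'
  clear hx'
  induction hx using Algebra.adjoin_induction with
  | mem y hy => exact ⟨0, 1, by simp [Set.mem_singleton_iff.1 hy]⟩
  | algebraMap r => exact ⟨r, 0, by simp⟩
  | add y z _ _ hy hz =>
    obtain ⟨u, v, rfl⟩ := hy
    obtain ⟨u', v', rfl⟩ := hz
    exact ⟨u + u', v + v', by simp only [map_add]; ring⟩
  | mul y z _ _ hy hz =>
    obtain ⟨u, v, rfl⟩ := hy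
    obtain ⟨u', v', rfl⟩ := hz
    refine ⟨u * u' + d * v * v', u * v' + v * u', ?_⟩
    simp only [map_add, map_mul]
    linear_combination (algebraMap ℚ E v * algebraMap ℚ E v') * hα

/-- The ideal class group of the ring of integers of `ℚ(√51)` is isomorphic to
`ℤ/2ℤ`, and the ideal class group of the ring of integers of `ℚ(√-51)` is also
isomorphic to `ℤ/2ℤ`. -/
theorem classGroup_sqrt51_and_sqrt_neg51 :
    Nonempty (ClassGroup (𝓞 ℚ⟮Real.sqrt (51 : ℕ)⟯) ≃* Multiplicative (ZMod 2)) ∧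
    Nonempty (ClassGroup (𝓞 ℚ⟮(Real.sqrt (51 : ℕ) : ℂ) * Complex.I⟯) ≃*
      Multiplicative (ZMod 2)) := by
  have h51 : Real.sqrt (51 : ℕ) * Real.sqrt (51 : ℕ) = 51 := by
    rw [Real.mul_self_sqrt (by positivity)]
    norm_num
  have h51' : ((Real.sqrt (51 : ℕ) : ℂ) * Complex.I) * ((Real.sqrt (51 : ℕ) : ℂ) * Complex.I)
      = -51 := by
    have h : (Real.sqrt (51 : ℕ) : ℂ) * (Real.sqrt (51 : ℕ) : ℂ) = 51 := by exact_mod_cast h51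
    linear_combination -h + Real.sqrt (51 : ℕ) * Real.sqrt (51 : ℕ) * Complex.I_mul_I
  constructor
  · refine nonempty_classGroup_mulEquiv_of_sqrt_fiftyOne
      (s := AdjoinSimple.gen ℚ (Real.sqrt (51 : ℕ))) (Subtype.ext h51)
      (exists_eq_smul_one_add_smul_gen (d := 51) ?_) ?_
    · rw [h51, map_ofNat]
    · let φ : ℚ⟮Real.sqrt (51 : ℕ)⟯ →+* ℂ :=
        Complex.ofRealHom.comp (algebraMap ℚ⟮Real.sqrt (51 : ℕ)⟯ ℝ)
      have hφ : ComplexEmbedding.IsReal φ := by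
        ext x
        simp [φ]
      classical
      exact Fintype.card_pos_iff.2 ⟨⟨InfinitePlace.mk φ, InfinitePlace.isReal_mk_iff.2 hφ⟩⟩
  · refine nonempty_classGroup_mulEquiv_of_sqrt_neg_fiftyOne
      (s := AdjoinSimple.gen ℚ ((Real.sqrt (51 : ℕ) : ℂ) * Complex.I)) (Subtype.ext h51')
      (exists_eq_smul_one_add_smul_gen (d := -51) ?_)
    rw [h51', map_neg, map_ofNat]
end
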